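/- Let k be an infinite cardinal and let X be an absolute G_δσ-set of first category such that Ind X = 0, X is nowhere 𝓕_σδ ∖ σLW(<k), and the weight of X equals k. Then X is homeomorphic to A^I_k = Q × A^{II}_k, where Q is the space of rational numbers. -/

import Mathlib

open Topology Set Filter

universe u v

noncomputable section

/-- Strong zero-dimensionality (`Ind X = 0`): any two disjoint closed sets
can be separated by a clopen set. -/
def StronglyZeroDim (X : Type*) [TopologicalSpace X] : Prop :=
  ∀ A B : Set X, IsClosed A → IsClosed B → Disjoint A B →
    ∃ U : Set X, IsClopen U ∧ A ⊆ U ∧ Disjoint B U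

/-- The topological weight of a space: the least cardinality of a base. -/
def topWeight (X : Type u) [TopologicalSpace X] : Cardinal.{u} :=
  ⨅ B : {B : Set (Set X) // TopologicalSpace.IsTopologicalBasis B}, Cardinal.mk B.1

/-- The space has a base of cardinality `< k`. -/
def WeightLT (X : Type u) [TopologicalSpace X] (k : Cardinal.{u}) : Prop :=
  ∃ B : Set (Set X), TopologicalSpace.IsTopologicalBasis B ∧ Cardinal.mk B < k

/-- Every point has a neighborhood of weight `< k`. -/
def LocallyWeightLT (X : Type u) [TopologicalSpace X] (k : Cardinal.{u}) : Prop :=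
  ∀ x : X, ∃ s : Set X, s ∈ nhds x ∧ WeightLT ↥s k

/-- `X ∈ σLW(<k)`: `X` is a countable union of subspaces, each locally of weight `< k`. -/
def SigmaLW (X : Type u) [TopologicalSpace X] (k : Cardinal.{u}) : Prop :=
  ∃ S : ℕ → Set X, (⋃ n, S n) = Set.univ ∧ ∀ n, LocallyWeightLT ↥(S n) k

/-- A `G_δσ`-subset: a countable union of `G_δ`-sets. -/
def IsGdeltaSigma {Y : Type*} [TopologicalSpace Y] (s : Set Y) : Prop :=
  ∃ G : ℕ → Set Y, (∀ n, IsGδ (G n)) ∧ s = ⋃ n, G n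

/-- An `F_σ`-subset: a countable union of closed sets. -/
def IsFsigmaSet {Y : Type*} [TopologicalSpace Y] (s : Set Y) : Prop :=
  ∃ F : ℕ → Set Y, (∀ n, IsClosed (F n)) ∧ s = ⋃ n, F n

/-- An `F_σδ`-subset: a countable intersection of `F_σ`-sets. -/
def IsFsigmaDelta {Y : Type*} [TopologicalSpace Y] (s : Set Y) : Prop :=
  ∃ F : ℕ → Set Y, (∀ n, IsFsigmaSet (F n)) ∧ s = ⋂ n, F n

/-- An absolute `G_δσ`-set: a metrizable space whose image under every embedding
into a metrizable space is a countable union of `G_δ`-sets. -/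
def AbsGdeltaSigma (X : Type u) [TopologicalSpace X] : Prop :=
  TopologicalSpace.MetrizableSpace X ∧
    ∀ (Y : Type u) [TopologicalSpace Y] [TopologicalSpace.MetrizableSpace Y]
      (f : X → Y), Topology.IsEmbedding f → IsGdeltaSigma (Set.range f)

/-- An absolute `F_σδ`-set: a metrizable space whose image under every embedding
into a metrizable space is an `F_σδ`-set. -/
def AbsFsigmaDelta (X : Type u) [TopologicalSpace X] : Prop :=
  TopologicalSpace.MetrizableSpace X ∧
    ∀ (Y : Type u) [TopologicalSpace Y] [TopologicalSpace.MetrizableSpace Y]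
      (f : X → Y), Topology.IsEmbedding f → IsFsigmaDelta (Set.range f)

/-- `X ∈ σLW(<k) + 𝒢_δσ` : `X = A ∪ B` with `A ∈ σLW(<k)` and `B` an absolute
`G_δσ`-set. -/
def SLWplusGDS (X : Type u) [TopologicalSpace X] (k : Cardinal.{u}) : Prop :=
  ∃ A B : Set X, A ∪ B = Set.univ ∧ SigmaLW ↥A k ∧ AbsGdeltaSigma ↥B

/-- No nonempty open subspace is `σLW(<k) + 𝒢_δσ`. -/
def NowhereSLWplusGDS (X : Type u) [TopologicalSpace X] (k : Cardinal.{u}) : Prop :=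
  ∀ U : Set X, IsOpen U → U.Nonempty → ¬ SLWplusGDS ↥U k

/-- A space is of first category if it is meager in itself. -/
def FirstCategory (X : Type*) [TopologicalSpace X] : Prop :=
  IsMeagre (Set.univ : Set X)

/-- A Souslin (analytic) subset of a space:
`s = ⋃_{t ∈ ω^ω} ⋂_n F(t↾n)` for a family of closed sets indexed by finite tuples. -/
def IsSuslinIn {Y : Type*} [TopologicalSpace Y] (s : Set Y) : Prop :=
  ∃ F : List ℕ → Set Y, (∀ l, IsClosed (F l)) ∧
    s = ⋃ t : ℕ → ℕ, ⋂ n : ℕ, F (List.ofFn fun i : Fin n => t i)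

/-- An absolute Souslin space: metrizable, and Souslin in every completely metrizable
space into which it embeds. -/
def AbsSuslin (X : Type u) [TopologicalSpace X] : Prop :=
  TopologicalSpace.MetrizableSpace X ∧
    ∀ (Y : Type u) [MetricSpace Y] [CompleteSpace Y] (f : X → Y),
      Topology.IsEmbedding f → IsSuslinIn (Set.range f)

/-- An h-homogeneous space: every nonempty clopen subset is homeomorphic to the
whole space. -/
def HHomogeneous (X : Type*) [TopologicalSpace X] : Prop :=
  ∀ U : Set X, IsClopen U → U.Nonempty → Nonempty (↥U ≃ₜ X)

/-- A discrete family of sets: every point has a neighborhood meeting at most one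
member of the family. -/
def DiscreteFamily {X : Type*} [TopologicalSpace X] {ι : Type*} (f : ι → Set X) : Prop :=
  ∀ x : X, ∃ U ∈ nhds x, {i | (f i ∩ U).Nonempty}.Subsingleton

/-- A discrete space of cardinality `k`. -/
def DiscT (k : Cardinal.{u}) : Type u := k.out

instance (k : Cardinal.{u}) : TopologicalSpace (DiscT k) := ⊥
instance (k : Cardinal.{u}) : DiscreteTopology (DiscT k) := ⟨rfl⟩

/-- The Baire space `B(k) = k^ω`. -/
def BaireB (k : Cardinal.{u}) : Type u := ℕ → DiscT k

instance (k : Cardinal.{u}) : TopologicalSpace (BaireB k) :=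
  inferInstanceAs (TopologicalSpace (ℕ → DiscT k))

open Classical in
/-- The discrete factor of `B*(k)`: two points if `k = ℵ₀`, and `k` points otherwise. -/
def StarT (k : Cardinal.{u}) : Type u :=
  if k = Cardinal.aleph0 then ULift Bool else DiscT k

instance (k : Cardinal.{u}) : TopologicalSpace (StarT k) := ⊥
instance (k : Cardinal.{u}) : DiscreteTopology (StarT k) := ⟨rfl⟩

/-- `B*(k)`: the Cantor set `2^ω` if `k = ℵ₀`, and the Baire space `B(k)` if `k > ℵ₀`. -/
def BaireStar (k : Cardinal.{u}) : Type u := ℕ → StarT k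

instance (k : Cardinal.{u}) : TopologicalSpace (BaireStar k) :=
  inferInstanceAs (TopologicalSpace (ℕ → StarT k))

/-- A discrete space of cardinality `k` (for infinite `k`), with a distinguished basepoint. -/
def QBase (k : Cardinal.{u}) : Type u := DiscT k ⊕ PUnit.{u + 1}

instance (k : Cardinal.{u}) : TopologicalSpace (QBase k) := ⊥
instance (k : Cardinal.{u}) : DiscreteTopology (QBase k) := ⟨rfl⟩

/-- `Q(k)`: the σ-product of `ω` copies of a discrete space of cardinality `k`, i.e.
the subspace of the product consisting of the sequences eventually equal to the basepoint. -/
def Qk (k : Cardinal.{u}) : Type u :=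
  {x : ℕ → QBase k // ∀ᶠ n in Filter.atTop, x n = Sum.inr PUnit.unit}

instance (k : Cardinal.{u}) : TopologicalSpace (Qk k) :=
  inferInstanceAs (TopologicalSpace
    {x : ℕ → QBase k // ∀ᶠ n in Filter.atTop, x n = Sum.inr PUnit.unit})

/-- The countable power `Q(k)^ω`. -/
def QkOmega (k : Cardinal.{u}) : Type u := ℕ → Qk k

instance (k : Cardinal.{u}) : TopologicalSpace (QkOmega k) :=
  inferInstanceAs (TopologicalSpace (ℕ → Qk k))

/-- `Z` is homeomorphic to `Q(k)^ω`. -/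
def IsQkOmega (k : Cardinal.{u}) (Z : Type*) [TopologicalSpace Z] : Prop :=
  Nonempty (Z ≃ₜ QkOmega k)

/-- `Z` is homeomorphic to `A^{II}_k`, the complement in `B*(k)` of a dense copy of
`Q(k)^ω`. -/
def IsAII (k : Cardinal.{u}) (Z : Type*) [TopologicalSpace Z] : Prop :=
  ∃ A : Set (BaireStar k), Dense A ∧ IsQkOmega k ↥A ∧ Nonempty (Z ≃ₜ ↥(Aᶜ))

/-- `Z` is homeomorphic to `A^I_k = Q × A^{II}_k`. -/
def IsAI (k : Cardinal.{u}) (Z : Type*) [TopologicalSpace Z] : Prop :=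
  ∃ A : Set (BaireStar k), Dense A ∧ IsQkOmega k ↥A ∧ Nonempty (Z ≃ₜ (ℚ × ↥(Aᶜ)))

/-- `Z` is homeomorphic to `M^{II}_k`, the complement in `B*(k)` of a dense copy of
`A^I_k`. -/
def IsMII (k : Cardinal.{u}) (Z : Type*) [TopologicalSpace Z] : Prop :=
  ∃ Y : Set (BaireStar k), Dense Y ∧ IsAI k ↥Y ∧ Nonempty (Z ≃ₜ ↥(Yᶜ))

/-- `X ∈ 𝓕_σδ ∖ σLW(<k)`: `X` is homeomorphic to `F ∖ L` for some absolute
`F_σδ`-space `F` and some `L ⊆ F` with `L ∈ σLW(<k)`. -/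
def FsdMinusSLW (X : Type u) [TopologicalSpace X] (k : Cardinal.{u}) : Prop :=
  ∃ (F : TopCat.{u}) (L : Set F), AbsFsigmaDelta ↥F ∧ SigmaLW ↥L k ∧
    Nonempty (X ≃ₜ ↥(Lᶜ))

/-- No nonempty open subspace is in the class `𝓕_σδ ∖ σLW(<k)`. -/
def NowhereFsdMinusSLW (X : Type u) [TopologicalSpace X] (k : Cardinal.{u}) : Prop :=
  ∀ U : Set X, IsOpen U → U.Nonempty → ¬ FsdMinusSLW ↥U k

/-- A topologically complete (i.e. completely metrizable) space. -/
def CompletelyMetrizable (X : Type*) [t : TopologicalSpace X] : Prop :=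
  ∃ m : MetricSpace X, m.toUniformSpace.toTopologicalSpace = t ∧
    @CompleteSpace X m.toUniformSpace

end


/-! ### Agreement of sequences -/

/-- Two sequences agree on their first `n` entries. -/
def ag {T : Type*} (n : ℕ) (x y : ℕ → T) : Prop := ∀ i < n, x i = y i

namespace ag
variable {T : Type*} {n m : ℕ} {x y z : ℕ → T}
theorem refl (n : ℕ) (x : ℕ → T) : ag n x x := fun _ _ => rfl
theorem symm (h : ag n x y) : ag n y x := fun i hi => (h i hi).symm
theorem trans (h : ag n x y) (h' : ag n y z) : ag n x z := fun i hi => (h i hi).trans (h' i hi)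
theorem mono (h : ag n x y) (hm : m ≤ n) : ag m x y := fun i hi => h i (hi.trans_le hm)
theorem zero (x y : ℕ → T) : ag 0 x y := fun i hi => absurd hi (Nat.not_lt_zero i)
end ag

theorem nhds_seq {T : Type*} [TopologicalSpace T] [DiscreteTopology T] {x : ℕ → T}
    {O : Set (ℕ → T)} : O ∈ 𝓝 x ↔ ∃ n, ∀ y, ag n y x → y ∈ O := by
  constructor
  · intro h
    rw [nhds_pi, Filter.mem_pi] at h
    obtain ⟨I, hI, t, ht, hO⟩ := h
    obtain ⟨n, hn⟩ := hI.bddAbove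
    refine ⟨n + 1, fun y hy => hO ?_⟩
    intro i hi
    rw [hy i (Nat.lt_succ_of_le (hn hi))]
    exact mem_of_mem_nhds (ht i)
  · rintro ⟨n, hn⟩
    have : (Set.pi (Set.Iio n) fun i => ({x i} : Set T)) ∈ 𝓝 x :=
      set_pi_mem_nhds (Set.finite_Iio n) fun i _ => by simp [nhds_discrete]
    refine Filter.mem_of_superset this fun y hy => hn y fun i hi => ?_
    simpa using hy i hi

theorem nhds_ind {X T : Type*} [TopologicalSpace X] [TopologicalSpace T] [DiscreteTopology T]
    {e : X → ℕ → T} (he : IsInducing e) {x : X}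
    {O : Set X} : O ∈ 𝓝 x ↔ ∃ n, ∀ y, ag n (e y) (e x) → y ∈ O := by
  rw [he.nhds_eq_comap, Filter.mem_comap]
  constructor
  · rintro ⟨t, ht, hO⟩
    obtain ⟨n, hn⟩ := nhds_seq.1 ht
    exact ⟨n, fun y hy => hO (hn _ hy)⟩
  · rintro ⟨n, hn⟩
    exact ⟨{z | ag n z (e x)}, nhds_seq.2 ⟨n, fun y hy => hy⟩, fun y hy => hn y hy⟩

theorem ev_ag {X T : Type*} [TopologicalSpace X] [TopologicalSpace T] [DiscreteTopology T]
    {e : X → ℕ → T} (he : IsInducing e) (x : X) (n : ℕ) : ∀ᶠ y in 𝓝 x, ag n (e y) (e x) :=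
  (nhds_ind he).2 ⟨n, fun _ h => h⟩

theorem isClopen_of_loc {X : Type*} [TopologicalSpace X] {O : Set X}
    (h : ∀ x, ∀ᶠ y in 𝓝 x, (y ∈ O ↔ x ∈ O)) : IsClopen O := by
  refine ⟨⟨isOpen_iff_mem_nhds.2 fun x hx => ?_⟩, isOpen_iff_mem_nhds.2 fun x hx => ?_⟩
  · filter_upwards [h x] with y hy using fun h' => hx (hy.1 h')
  · filter_upwards [h x] with y hy using hy.2 hx

theorem loc_of_isClopen {X : Type*} [TopologicalSpace X] {O : Set X} (h : IsClopen O) (x : X) :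
    ∀ᶠ y in 𝓝 x, (y ∈ O ↔ x ∈ O) := by
  by_cases hx : x ∈ O
  · filter_upwards [h.isOpen.mem_nhds hx] with y hy using ⟨fun _ => hx, fun _ => hy⟩
  · filter_upwards [h.compl.isOpen.mem_nhds hx] with y hy using
      ⟨fun h => absurd h hy, fun h => absurd h hx⟩

open Classical in
/-- A choice of an element of a set, depending on the set only. -/
noncomputable def selIn {Z : Type*} [Nonempty Z] (S : Set Z) : Z :=
  if h : S.Nonempty then h.some else Classical.arbitrary Z

theorem selIn_mem {Z : Type*} [Nonempty Z] {S : Set Z} (h : S.Nonempty) : selIn S ∈ S := by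
  unfold selIn; rw [dif_pos h]; exact h.some_mem

/-! ### Knaster–Reichbach type decomposition of the complement of a nowhere dense closed set -/

theorem KR1 {X Z T : Type*} [TopologicalSpace X] [TopologicalSpace Z] [TopologicalSpace T]
    [DiscreteTopology T] [Nonempty Z] (e : X → ℕ → T) (he : IsInducing e)
    (α : Z → X) (hα : IsClosedEmbedding α) (E : Z → ℕ → T) (hE : IsInducing E)
    (U : Set X) (hU : IsClopen U) (hαU : ∀ z, α z ∈ U)
    (hnint : ∀ z, ∀ O ∈ 𝓝 (α z), ∃ x ∈ O, x ∉ range α) :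
    ∃ (lev : X → ℕ) (ρ : X → Z),
      (∀ x ∈ U, x ∉ range α → ∀ᶠ x' in 𝓝 x, (x' ∈ U ∧ x' ∉ range α) ∧ lev x' = lev x ∧ ρ x' = ρ x) ∧
      (∀ n z, ∃ x ∈ U, x ∉ range α ∧ lev x = n ∧ ag n (E (ρ x)) (E z)) ∧
      (∀ z n, ∀ᶠ x in 𝓝 (α z), x ∉ range α → n ≤ lev x ∧ ag n (E (ρ x)) (E z)) ∧
      (∀ z, ∀ O ∈ 𝓝 (α z), ∃ n, ∀ x ∈ U, x ∉ range α → n ≤ lev x → ag n (E (ρ x)) (E z) → x ∈ O) := by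
  classical
  have : Nonempty X := ⟨α (Classical.arbitrary Z)⟩
  set A := range α with hA
  set L : X → ℕ := fun x => sInf {n | ∀ z, ¬ ag n (e (α z)) (e x)} with hL
  have Lmem : ∀ x, x ∉ A → ∀ z, ¬ ag (L x) (e (α z)) (e x) := by
    intro x hx
    have : Aᶜ ∈ 𝓝 x := hα.isClosed_range.isOpen_compl.mem_nhds hx
    obtain ⟨n, hn⟩ := (nhds_ind he).1 this
    have hne : {n | ∀ z, ¬ ag n (e (α z)) (e x)}.Nonempty :=
      ⟨n, fun z hz => hn _ hz ⟨z, rfl⟩⟩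
    exact Nat.sInf_mem hne
  have Lle : ∀ x n, (∀ z, ¬ ag n (e (α z)) (e x)) → L x ≤ n := fun x n h => Nat.sInf_le h
  have Lgt : ∀ x n z, x ∉ A → ag n (e (α z)) (e x) → n < L x := by
    intro x n z hx h
    by_contra hc
    exact Lmem x hx z (h.mono (not_lt.1 hc))
  set ρ : X → Z := fun x => selIn {z | ag (L x - 1) (e (α z)) (e x)} with hρ
  have ρspec : ∀ x, x ∉ A → ag (L x - 1) (e (α (ρ x))) (e x) := by
    intro x hx
    have h0 : 0 < L x := Lgt x 0 (Classical.arbitrary Z) hx (ag.zero _ _)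
    have : {z | ag (L x - 1) (e (α z)) (e x)}.Nonempty := by
      by_contra hc
      have := Lle x (L x - 1) fun z hz => hc ⟨z, hz⟩
      omega
    exact selIn_mem this
  have locc : ∀ x x', x ∉ A → ag (L x) (e x') (e x) → x' ∉ A ∧ L x' = L x ∧ ρ x' = ρ x := by
    intro x x' hx hxx
    have key : ∀ n ≤ L x, ∀ z, ag n (e (α z)) (e x') ↔ ag n (e (α z)) (e x) := fun n hn z =>
      ⟨fun h => h.trans (hxx.mono hn), fun h => h.trans (hxx.mono hn).symm⟩
    have h1 : x' ∉ A := by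
      rintro ⟨z, rfl⟩
      exact Lmem x hx z hxx
    have h2 : L x' = L x := by
      have a : L x' ≤ L x := Lle _ _ fun z hz => Lmem x hx z ((key _ le_rfl z).1 hz)
      have b : L x ≤ L x' := Lle _ _ fun z hz => Lmem x' h1 z ((key _ a z).2 hz)
      omega
    refine ⟨h1, h2, ?_⟩
    simp only [hρ, h2]
    congr 1
    ext z
    exact key _ (Nat.sub_le _ _) z
  have locc' : ∀ x, x ∉ A → ∀ᶠ x' in 𝓝 x, x' ∉ A ∧ L x' = L x ∧ ρ x' = ρ x := by
    intro x hx
    filter_upwards [ev_ag he x (L x)] with x' h using locc x x' hx h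
  have conv : ∀ z N, ∀ᶠ x in 𝓝 (α z), x ∉ A → N < L x := by
    intro z N
    filter_upwards [ev_ag he (α z) N] with x h hx using Lgt x N z hx h.symm
  have hea : IsInducing (e ∘ α) := he.comp hα.isInducing
  have conv2 : ∀ z n, ∀ᶠ x in 𝓝 (α z), x ∉ A → ag n (E (ρ x)) (E z) := by
    intro z n
    obtain ⟨N, hN⟩ := (nhds_ind hea).1 (ev_ag hE z n)
    filter_upwards [ev_ag he (α z) N, conv z N] with x h h' hx
    refine hN _ (((ρspec x hx).mono ?_).trans h)
    have := h' hx
    omega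
  have step : ∀ (n : ℕ) (O : Set X), IsClopen O → A ⊆ O → ∃ O' : Set X, IsClopen O' ∧ A ⊆ O' ∧
      O' ⊆ O ∧ (∀ x ∈ O', x ∉ A → n + 1 < L x) ∧
      ∀ z, ∃ x ∈ O, x ∉ O' ∧ x ∉ A ∧ ag n (E (ρ x)) (E z) := by
    intro n O hO hAO
    set S : Z → Set X := fun z => {x' | x' ∈ O ∧ x' ∉ A ∧ ag n (E (ρ x')) (E z)} with hS
    have Seq : ∀ z z', ag n (E z) (E z') → S z = S z' := by
      intro z z' h
      ext x'
      exact ⟨fun h' => ⟨h'.1, h'.2.1, h'.2.2.trans h⟩, fun h' => ⟨h'.1, h'.2.1, h'.2.2.trans h.symm⟩⟩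
    refine ⟨{x | x ∈ A ∨ (x ∈ O ∧ n + 1 < L x ∧ L (selIn (S (ρ x))) < L x)}, ?_, ?_, ?_, ?_, ?_⟩
    · apply isClopen_of_loc
      intro x
      by_cases hx : x ∈ A
      · obtain ⟨z, rfl⟩ := hx
        filter_upwards [hO.isOpen.mem_nhds (hAO ⟨z, rfl⟩), conv z (n + 1),
          conv z (L (selIn (S z))), conv2 z n] with x' h1 h2 h3 h4
        refine ⟨fun _ => Or.inl ⟨z, rfl⟩, fun _ => ?_⟩
        by_cases hx' : x' ∈ A
        · exact Or.inl hx'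
        · refine Or.inr ⟨h1, h2 hx', ?_⟩
          rw [Seq _ _ (h4 hx')]
          exact h3 hx'
      · filter_upwards [locc' x hx, loc_of_isClopen hO x] with x' h1 h2
        simp only [Set.mem_ofPred_eq, h1.2.1, h1.2.2, h2, hx, h1.1]
    · exact fun x hx => Or.inl hx
    · rintro x (hx | hx)
      · exact hAO hx
      · exact hx.1
    · rintro x (hx | hx) hxA
      · exact absurd hx hxA
      · exact hx.2.1
    · intro z
      have hne : (S z).Nonempty := by
        obtain ⟨x, hx, hxA⟩ := hnint z _ ((conv2 z n).and (hO.isOpen.mem_nhds (hAO ⟨z, rfl⟩)))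
        exact ⟨x, hx.2, hxA, hx.1 hxA⟩
      have hm := selIn_mem hne
      refine ⟨selIn (S z), hm.1, ?_, hm.2.1, hm.2.2⟩
      rintro (h | h)
      · exact hm.2.1 h
      · have := h.2.2
        rw [Seq _ _ hm.2.2] at this
        exact lt_irrefl _ this
  choose! nxt n1 n2 n3 n4 n5 using step
  set O : ℕ → Set X := fun n => Nat.rec U (fun n O => nxt n O) n with hOdef
  have O0 : O 0 = U := rfl
  have Os : ∀ n, O (n + 1) = nxt n (O n) := fun n => rfl
  have hO : ∀ n, IsClopen (O n) ∧ A ⊆ O n := by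
    intro n
    induction n with
    | zero => exact ⟨hU, by rintro _ ⟨z, rfl⟩; exact hαU z⟩
    | succ n ih => rw [Os]; exact ⟨n1 n _ ih.1 ih.2, n2 n _ ih.1 ih.2⟩
  have Oanti : Antitone O := antitone_nat_of_succ_le fun n => n3 n _ (hO n).1 (hO n).2
  have OL : ∀ n x, x ∈ O (n + 1) → x ∉ A → n + 1 < L x := fun n => n4 n _ (hO n).1 (hO n).2
  set lev : X → ℕ := fun x => sInf {n | x ∉ O (n + 1)} with hlev
  have levmem : ∀ x, x ∉ A → x ∉ O (lev x + 1) := by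
    intro x hx
    have : {n | x ∉ O (n + 1)}.Nonempty := ⟨L x, fun h => by have := OL _ _ h hx; omega⟩
    exact Nat.sInf_mem this
  have levle : ∀ x n, x ∉ O (n + 1) → lev x ≤ n := fun x n h => Nat.sInf_le h
  have levge : ∀ x n, x ∉ A → x ∈ O n → n ≤ lev x := by
    intro x n hx h
    by_contra hc
    exact levmem x hx (Oanti (show lev x + 1 ≤ n by omega) h)
  have levO : ∀ x, x ∈ U → x ∈ O (lev x) := by
    intro x hx
    rcases Nat.eq_zero_or_pos (lev x) with h | h
    · rw [h]; exact hx
    · by_contra hc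
      have := levle x (lev x - 1) (by rwa [Nat.sub_add_cancel h])
      omega
  refine ⟨lev, ρ, ?_, ?_, ?_, ?_⟩
  · intro x hx hxA
    filter_upwards [locc' x hxA, loc_of_isClopen (hO (lev x)).1 x,
      loc_of_isClopen (hO (lev x + 1)).1 x, hU.isOpen.mem_nhds hx] with x' h1 h2 h3 h4
    refine ⟨⟨h4, h1.1⟩, le_antisymm ?_ ?_, h1.2.2⟩
    · exact levle _ _ fun h => levmem x hxA (h3.1 h)
    · exact levge _ _ h1.1 (h2.2 (levO x hx))
  · intro n z
    obtain ⟨x, h1, h2, h3, h4⟩ := n5 n (O n) (hO n).1 (hO n).2 z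
    exact ⟨x, Oanti (Nat.zero_le n) h1, h3, le_antisymm (levle _ _ h2) (levge _ _ h3 h1), h4⟩
  · intro z n
    filter_upwards [conv2 z n, (hO n).1.isOpen.mem_nhds ((hO n).2 ⟨z, rfl⟩)] with x h1 h2 hx
    exact ⟨levge _ _ hx h2, h1 hx⟩
  · intro z V hV
    obtain ⟨N, hN⟩ := (nhds_ind he).1 hV
    obtain ⟨n, hn⟩ := (nhds_ind hE).1 (ev_ag hea z N)
    refine ⟨max n N + 1, fun x hx hxA hl hag => hN x ?_⟩
    have h1 : x ∈ O (max n N + 1) := Oanti hl (levO x hx)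
    have h2 := OL _ _ h1 hxA
    have h3 : ag N (e (α (ρ x))) (e (α z)) := hn _ (hag.mono (by omega))
    exact ((ρspec x hxA).mono (by omega)).symm.trans h3



/-! ### Back-and-forth through decreasing relations -/

section BF
variable {X M : Type*} [TopologicalSpace X] [TopologicalSpace M]

/-- The pair `(x, y)` is finally matched by the relation `R`. -/
def DoneP (R : X → M → Prop) (x : X) (y : M) : Prop :=
  R x y ∧ (∀ y', R x y' → y' = y) ∧ (∀ x', R x' y → x' = x) ∧
  (∀ V ∈ 𝓝 y, ∀ᶠ x' in 𝓝 x, ∀ y', R x' y' → y' ∈ V) ∧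
  (∀ U ∈ 𝓝 x, ∀ᶠ y' in 𝓝 y, ∀ x', R x' y' → x' ∈ U)

/-- The pair `(x, y)` lies in a clopen rectangle which is a block of `R`. -/
def RectP (R : X → M → Prop) (x : X) (y : M) : Prop :=
  ∃ U V, IsClopen U ∧ IsClopen V ∧ x ∈ U ∧ y ∈ V ∧
    ∀ x' y', (x' ∈ U ∨ y' ∈ V) → (R x' y' ↔ (x' ∈ U ∧ y' ∈ V))

/-- `R` is a good total relation between the sets `U` and `V`. -/
def LocRel (U : Set X) (V : Set M) (R : X → M → Prop) : Prop :=
  (∀ x y, R x y → x ∈ U ∧ y ∈ V) ∧ (∀ x ∈ U, ∃ y, R x y) ∧ (∀ y ∈ V, ∃ x, R x y) ∧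
  ∀ x y, R x y → DoneP R x y ∨ RectP R x y

theorem DoneP.mono {R R' : X → M → Prop} {x : X} {y : M} (h : DoneP R x y)
    (hR : ∀ x y, R' x y → R x y) (hxy : R' x y) : DoneP R' x y := by
  obtain ⟨_, h1, h2, h3, h4⟩ := h
  refine ⟨hxy, fun y' h => h1 _ (hR _ _ h), fun x' h => h2 _ (hR _ _ h), fun V hV => ?_,
    fun U hU => ?_⟩
  · filter_upwards [h3 V hV] with x' h y' hy' using h _ (hR _ _ hy')
  · filter_upwards [h4 U hU] with x' h y' hy' using h _ (hR _ _ hy')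

theorem loc_exists {Z T : Type*} [TopologicalSpace Z] [TopologicalSpace T]
    [DiscreteTopology T] [Nonempty Z]
    (e : X → ℕ → T) (he : IsInducing e) (e' : M → ℕ → T) (he' : IsInducing e')
    (α : Z → X) (hα : IsClosedEmbedding α) (β : Z → M) (hβ : IsClosedEmbedding β)
    (U : Set X) (hU : IsClopen U) (hαU : ∀ z, α z ∈ U)
    (V : Set M) (hV : IsClopen V) (hβV : ∀ z, β z ∈ V)
    (hnint : ∀ z, ∀ O ∈ 𝓝 (α z), ∃ x ∈ O, x ∉ range α)
    (hnint' : ∀ z, ∀ O ∈ 𝓝 (β z), ∃ x ∈ O, x ∉ range β) :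
    ∃ R : X → M → Prop, LocRel U V R ∧ ∀ x y, R x y → (x ∈ range α ∨ y ∈ range β) →
      DoneP R x y := by
  set E := e ∘ α with hEdef
  have hE : IsInducing E := he.comp hα.isInducing
  obtain ⟨lev, ρ, a1, b1, c1, d1⟩ := KR1 e he α hα E hE U hU hαU hnint
  obtain ⟨lev', ρ', a2, b2, c2, d2⟩ := KR1 e' he' β hβ E hE V hV hβV hnint'
  set R : X → M → Prop := fun x y => (∃ z, x = α z ∧ y = β z) ∨
    ((x ∈ U ∧ x ∉ range α) ∧ (y ∈ V ∧ y ∉ range β) ∧ lev x = lev' y ∧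
      ag (lev x) (E (ρ x)) (E (ρ' y))) with hR
  have done : ∀ z, DoneP R (α z) (β z) := by
    intro z
    refine ⟨Or.inl ⟨z, rfl, rfl⟩, ?_, ?_, ?_, ?_⟩
    · rintro y' (⟨z', h1, h2⟩ | h)
      · rw [h2, hα.injective h1]
      · exact absurd ⟨z, rfl⟩ h.1.2
    · rintro y' (⟨z', h1, h2⟩ | h)
      · rw [h1, hβ.injective h2]
      · exact absurd ⟨z, rfl⟩ h.2.1.2
    · intro O hO
      obtain ⟨n, hn⟩ := d2 z O hO
      have hO' : β ⁻¹' O ∈ 𝓝 z := hβ.continuous.continuousAt hO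
      rw [hα.isInducing.nhds_eq_comap, Filter.mem_comap] at hO'
      obtain ⟨O', hO', hs⟩ := hO'
      filter_upwards [c1 z n, hO'] with x hx hxO y hxy
      rcases hxy with ⟨z', rfl, rfl⟩ | ⟨h1, h2, h3, h4⟩
      · exact hs hxO
      · obtain ⟨h5, h6⟩ := hx h1.2
        exact hn y h2.1 h2.2 (h3 ▸ h5) ((h4.mono h5).symm.trans h6)
    · intro O hO
      obtain ⟨n, hn⟩ := d1 z O hO
      have hO' : α ⁻¹' O ∈ 𝓝 z := hα.continuous.continuousAt hO
      rw [hβ.isInducing.nhds_eq_comap, Filter.mem_comap] at hO'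
      obtain ⟨O', hO', hs⟩ := hO'
      filter_upwards [c2 z n, hO'] with y hy hyO x hxy
      rcases hxy with ⟨z', rfl, rfl⟩ | ⟨h1, h2, h3, h4⟩
      · exact hs hyO
      · obtain ⟨h5, h6⟩ := hy h2.2
        exact hn x h1.1 h1.2 (h3 ▸ h5) ((h4.mono (h3 ▸ h5)).trans h6)
  have hdone : ∀ x y, R x y → (x ∈ range α ∨ y ∈ range β) → DoneP R x y := by
    rintro x y (⟨z, rfl, rfl⟩ | h) hxy
    · exact done z
    · rcases hxy with hxy | hxy
      · exact absurd hxy h.1.2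
      · exact absurd hxy h.2.1.2
  have pieceX : ∀ n (w : ℕ → T), IsClopen {x | (x ∈ U ∧ x ∉ range α) ∧ lev x = n ∧
      ag n (E (ρ x)) w} := by
    intro n w
    apply isClopen_of_loc
    intro x
    by_cases hx : x ∈ range α
    · obtain ⟨z, rfl⟩ := hx
      filter_upwards [c1 z (n + 1)] with x' h
      refine ⟨fun h' => ?_, fun h' => absurd ⟨z, rfl⟩ h'.1.2⟩
      have h1 := (h h'.1.2).1
      have h2 := h'.2.1
      omega
    · by_cases hxU : x ∈ U
      · filter_upwards [a1 x hxU hx] with x' h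
        simp only [Set.mem_ofPred_eq, h.2.1, h.2.2, h.1.1, h.1.2, hxU, hx]
      · filter_upwards [hU.compl.isOpen.mem_nhds hxU] with x' h
        exact ⟨fun h' => absurd h'.1.1 h, fun h' => absurd h'.1.1 hxU⟩
  have pieceY : ∀ n (w : ℕ → T), IsClopen {x | (x ∈ V ∧ x ∉ range β) ∧ lev' x = n ∧
      ag n (E (ρ' x)) w} := by
    intro n w
    apply isClopen_of_loc
    intro x
    by_cases hx : x ∈ range β
    · obtain ⟨z, rfl⟩ := hx
      filter_upwards [c2 z (n + 1)] with x' h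
      refine ⟨fun h' => ?_, fun h' => absurd ⟨z, rfl⟩ h'.1.2⟩
      have h1 := (h h'.1.2).1
      have h2 := h'.2.1
      omega
    · by_cases hxU : x ∈ V
      · filter_upwards [a2 x hxU hx] with x' h
        simp only [Set.mem_ofPred_eq, h.2.1, h.2.2, h.1.1, h.1.2, hxU, hx]
      · filter_upwards [hV.compl.isOpen.mem_nhds hxU] with x' h
        exact ⟨fun h' => absurd h'.1.1 h, fun h' => absurd h'.1.1 hxU⟩
  refine ⟨R, ⟨?_, ?_, ?_, ?_⟩, hdone⟩
  · rintro x y (⟨z, rfl, rfl⟩ | h)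
    · exact ⟨hαU z, hβV z⟩
    · exact ⟨h.1.1, h.2.1.1⟩
  · intro x hx
    by_cases hxA : x ∈ range α
    · obtain ⟨z, rfl⟩ := hxA
      exact ⟨β z, Or.inl ⟨z, rfl, rfl⟩⟩
    · obtain ⟨y, h1, h2, h3, h4⟩ := b2 (lev x) (ρ x)
      exact ⟨y, Or.inr ⟨⟨hx, hxA⟩, ⟨h1, h2⟩, h3.symm, h4.symm⟩⟩
  · intro y hy
    by_cases hyB : y ∈ range β
    · obtain ⟨z, rfl⟩ := hyB
      exact ⟨α z, Or.inl ⟨z, rfl, rfl⟩⟩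
    · obtain ⟨x, h1, h2, h3, h4⟩ := b1 (lev' y) (ρ' y)
      exact ⟨x, Or.inr ⟨⟨h1, h2⟩, ⟨hy, hyB⟩, h3, h3 ▸ h4⟩⟩
  · intro x y hxy
    by_cases hxA : x ∈ range α
    · exact Or.inl (hdone x y hxy (Or.inl hxA))
    right
    rcases hxy with ⟨z, rfl, rfl⟩ | ⟨h1, h2, h3, h4⟩
    · exact absurd ⟨z, rfl⟩ hxA
    refine ⟨_, _, pieceX (lev x) (E (ρ x)), pieceY (lev x) (E (ρ x)),
      ⟨h1, rfl, ag.refl _ _⟩, ⟨h2, h3.symm, h4.symm⟩, ?_⟩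
    rintro x' y' (h | h)
    · obtain ⟨h5, h6, h7⟩ := h
      constructor
      · rintro (⟨z, rfl, rfl⟩ | ⟨g1, g2, g3, g4⟩)
        · exact absurd ⟨z, rfl⟩ h5.2
        · exact ⟨⟨h5, h6, h7⟩, g2, g3.symm.trans h6, (h6 ▸ g4).symm.trans h7⟩
      · rintro ⟨_, g1, g2, g3⟩
        exact Or.inr ⟨h5, g1, h6.trans g2.symm, by rw [h6]; exact h7.trans g3.symm⟩
    · obtain ⟨h5, h6, h7⟩ := h
      constructor
      · rintro (⟨z, rfl, rfl⟩ | ⟨g1, g2, g3, g4⟩)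
        · exact absurd ⟨z, rfl⟩ h5.2
        · have : lev x' = lev x := g3.trans h6
          exact ⟨⟨g1, this, (this ▸ g4).trans h7⟩, g2, h6, h7⟩
      · rintro ⟨⟨g1, g2, g3⟩, _⟩
        exact Or.inr ⟨g1, h5, g2.trans h6.symm, by rw [g2]; exact g3.trans h7.symm⟩

theorem step_rel (p : X → M → Prop)
    (H : ∀ (U : Set X) (V : Set M), IsClopen U → IsClopen V → U.Nonempty → V.Nonempty →
      ∃ Q, LocRel U V Q ∧ ∀ x y, p x y → Q x y → DoneP Q x y)
    (R : X → M → Prop) (hR : LocRel univ univ R) :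
    ∃ R' : X → M → Prop, LocRel univ univ R' ∧ (∀ x y, R' x y → R x y) ∧
      ∀ x y, p x y → R' x y → DoneP R' x y := by
  choose! Q hQ hp using H
  obtain ⟨-, t1, t2, hDR⟩ := hR
  set R' : X → M → Prop := fun x y => R x y ∧ (DoneP R x y ∨
    (RectP R x y ∧ Q {x' | R x' y} {y' | R x y'} x y)) with hR'
  have sub : ∀ x y, R' x y → R x y := fun x y h => h.1
  have fib : ∀ (U : Set X) (V : Set M), (∀ x' y', (x' ∈ U ∨ y' ∈ V) → (R x' y' ↔ (x' ∈ U ∧ y' ∈ V))) →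
      ∀ x y, x ∈ U → y ∈ V → {x' | R x' y} = U ∧ {y' | R x y'} = V := by
    intro U V h x y hx hy
    constructor
    · ext x'
      exact (h x' y (Or.inr hy)).trans ⟨fun h => h.1, fun h => ⟨h, hy⟩⟩
    · ext y'
      exact (h x y' (Or.inl hx)).trans ⟨fun h => h.2, fun h => ⟨hx, h⟩⟩
  have block : ∀ (U : Set X) (V : Set M), IsClopen U → IsClopen V → U.Nonempty → V.Nonempty →
      (∀ x' y', (x' ∈ U ∨ y' ∈ V) → (R x' y' ↔ (x' ∈ U ∧ y' ∈ V))) →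
      ∀ x' y', (x' ∈ U ∨ y' ∈ V) → (R' x' y' ↔ Q U V x' y') := by
    intro U V hU hV hUn hVn h x' y' hxy
    obtain ⟨q1, q2, q3, q4⟩ := hQ U V hU hV hUn hVn
    constructor
    · rintro ⟨g1, g2⟩
      have hmem := (h x' y' hxy).1 g1
      obtain ⟨f1, f2⟩ := fib U V h x' y' hmem.1 hmem.2
      rcases g2 with g2 | g2
      · obtain ⟨y2, hy2⟩ := q2 x' hmem.1
        have : y2 = y' := g2.2.1 y2 ((h x' y2 (Or.inl hmem.1)).2 (q1 _ _ hy2))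
        rwa [← this]
      · rw [f1, f2] at g2
        exact g2.2
    · intro g
      have hmem := q1 _ _ g
      obtain ⟨f1, f2⟩ := fib U V h x' y' hmem.1 hmem.2
      refine ⟨(h x' y' hxy).2 hmem, Or.inr ⟨⟨U, V, hU, hV, hmem.1, hmem.2, h⟩, ?_⟩⟩
      rw [f1, f2]
      exact g
  have tr : ∀ (U : Set X) (V : Set M), IsClopen U → IsClopen V →
      (∀ x' y', (x' ∈ U ∨ y' ∈ V) → (R x' y' ↔ (x' ∈ U ∧ y' ∈ V))) →
      ∀ x y, x ∈ U → y ∈ V → R' x y → DoneP (Q U V) x y → DoneP R' x y := by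
    intro U V hU hV h x y hx hy hxy hd
    have hb := block U V hU hV ⟨x, hx⟩ ⟨y, hy⟩ h
    obtain ⟨d0, d1, d2, d3, d4⟩ := hd
    refine ⟨hxy, fun y' h => d1 _ ((hb _ _ (Or.inl hx)).1 h),
      fun x' h => d2 _ ((hb _ _ (Or.inr hy)).1 h), fun O hO => ?_, fun O hO => ?_⟩
    · filter_upwards [d3 O hO, hU.isOpen.mem_nhds hx] with x' g1 g2 y' g3
      exact g1 _ ((hb _ _ (Or.inl g2)).1 g3)
    · filter_upwards [d4 O hO, hV.isOpen.mem_nhds hy] with x' g1 g2 y' g3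
      exact g1 _ ((hb _ _ (Or.inr g2)).1 g3)
  refine ⟨R', ⟨fun _ _ _ => ⟨trivial, trivial⟩, ?_, ?_, ?_⟩, sub, ?_⟩
  · intro x _
    obtain ⟨y, hy⟩ := t1 x trivial
    rcases hDR x y hy with h | ⟨U, V, hU, hV, hx, hyV, h⟩
    · exact ⟨y, hy, Or.inl h⟩
    · obtain ⟨y2, hy2⟩ := (hQ U V hU hV ⟨x, hx⟩ ⟨y, hyV⟩).2.1 x hx
      exact ⟨y2, (block U V hU hV ⟨x, hx⟩ ⟨y, hyV⟩ h x y2 (Or.inl hx)).2 hy2⟩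
  · intro y _
    obtain ⟨x, hy⟩ := t2 y trivial
    rcases hDR x y hy with h | ⟨U, V, hU, hV, hx, hyV, h⟩
    · exact ⟨x, hy, Or.inl h⟩
    · obtain ⟨x2, hx2⟩ := (hQ U V hU hV ⟨x, hx⟩ ⟨y, hyV⟩).2.2.1 y hyV
      exact ⟨x2, (block U V hU hV ⟨x, hx⟩ ⟨y, hyV⟩ h x2 y (Or.inr hyV)).2 hx2⟩
  · intro x y hxy
    rcases hDR x y hxy.1 with h | ⟨U, V, hU, hV, hx, hyV, h⟩
    · exact Or.inl (h.mono sub hxy)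
    · have hb := block U V hU hV ⟨x, hx⟩ ⟨y, hyV⟩ h
      have hq := (hb x y (Or.inl hx)).1 hxy
      obtain ⟨q1, q2, q3, q4⟩ := hQ U V hU hV ⟨x, hx⟩ ⟨y, hyV⟩
      rcases q4 x y hq with g | ⟨U1, V1, hU1, hV1, hx1, hy1, g⟩
      · exact Or.inl (tr U V hU hV h x y hx hyV hxy g)
      · refine Or.inr ⟨U1 ∩ U, V1 ∩ V, hU1.inter hU, hV1.inter hV, ⟨hx1, hx⟩, ⟨hy1, hyV⟩, ?_⟩
        intro x' y' hx'
        have hor : x' ∈ U ∨ y' ∈ V := hx'.imp (fun h => h.2) (fun h => h.2)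
        have hor1 : x' ∈ U1 ∨ y' ∈ V1 := hx'.imp (fun h => h.1) (fun h => h.1)
        constructor
        · intro k
          have k1 := (hb _ _ hor).1 k
          have k2 := (g _ _ hor1).1 k1
          have k3 := q1 _ _ k1
          exact ⟨⟨k2.1, k3.1⟩, k2.2, k3.2⟩
        · rintro ⟨k1, k2⟩
          exact (hb _ _ hor).2 ((g _ _ hor1).2 ⟨k1.1, k2.1⟩)
  · intro x y hpx hxy
    rcases hDR x y hxy.1 with h | ⟨U, V, hU, hV, hx, hyV, h⟩
    · exact h.mono sub hxy
    · have hb := block U V hU hV ⟨x, hx⟩ ⟨y, hyV⟩ h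
      exact tr U V hU hV h x y hx hyV hxy
        (hp U V hU hV ⟨x, hx⟩ ⟨y, hyV⟩ x y hpx ((hb _ _ (Or.inl hx)).1 hxy))

theorem homeo_of_rels (R : ℕ → X → M → Prop) (hR : ∀ n, LocRel univ univ (R n))
    (hsub : ∀ n x y, R (n + 1) x y → R n x y)
    (hX : ∀ x, ∃ n, ∀ y, R n x y → DoneP (R n) x y)
    (hM : ∀ y, ∃ n, ∀ x, R n x y → DoneP (R n) x y) : Nonempty (X ≃ₜ M) := by
  have hmono : ∀ m n, m ≤ n → ∀ x y, R n x y → R m x y := by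
    intro m n hmn
    induction hmn with
    | refl => exact fun _ _ h => h
    | step _ ih => exact fun x y h => ih _ _ (hsub _ _ _ h)
  have dmono : ∀ m n, m ≤ n → ∀ x y, DoneP (R m) x y → DoneP (R n) x y := by
    intro m n hmn x y h
    obtain ⟨y', hy'⟩ := (hR n).2.1 x trivial
    have : y' = y := h.2.1 _ (hmono m n hmn _ _ hy')
    exact h.mono (hmono m n hmn) (this ▸ hy')
  have h1 : ∀ x, ∃ y n, DoneP (R n) x y := by
    intro x
    obtain ⟨n, hn⟩ := hX x
    obtain ⟨y, hy⟩ := (hR n).2.1 x trivial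
    exact ⟨y, n, hn y hy⟩
  have h2 : ∀ y, ∃ x n, DoneP (R n) x y := by
    intro y
    obtain ⟨n, hn⟩ := hM y
    obtain ⟨x, hx⟩ := (hR n).2.2.1 y trivial
    exact ⟨x, n, hn x hx⟩
  choose f nf hf using h1
  choose g ng hg using h2
  have gf : ∀ x, g (f x) = x := by
    intro x
    have a := dmono _ _ (le_max_left (nf x) (ng (f x))) _ _ (hf x)
    have b := dmono _ _ (le_max_right (nf x) (ng (f x))) _ _ (hg (f x))
    exact a.2.2.1 _ b.1
  have fg : ∀ y, f (g y) = y := by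
    intro y
    have a := dmono _ _ (le_max_left (nf (g y)) (ng y)) _ _ (hf (g y))
    have b := dmono _ _ (le_max_right (nf (g y)) (ng y)) _ _ (hg y)
    exact b.2.1 _ a.1
  have Rf : ∀ n x, R n x (f x) := fun n x =>
    hmono n _ (le_max_right (nf x) n) _ _ (dmono _ _ (le_max_left (nf x) n) _ _ (hf x)).1
  refine ⟨⟨⟨f, g, gf, fg⟩, ?_, ?_⟩⟩
  · refine continuous_iff_continuousAt.2 fun x O hO => ?_
    show ∀ᶠ x' in 𝓝 x, f x' ∈ O
    filter_upwards [(hf x).2.2.2.1 O hO] with x' h using h _ (Rf _ _)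
  · refine continuous_iff_continuousAt.2 fun y O hO => ?_
    show ∀ᶠ y' in 𝓝 y, g y' ∈ O
    filter_upwards [(hg y).2.2.2.2 O hO] with y' h
    have := h (g y') (by have := Rf (ng y) (g y'); rwa [fg] at this)
    exact this

/-- `E` can be embedded as a closed nowhere dense set into every nonempty open set of `M`. -/
def EmbEverywhere (Z : Type*) [TopologicalSpace Z] (M : Type*) [TopologicalSpace M] : Prop :=
  ∀ V : Set M, IsOpen V → V.Nonempty → ∃ f : Z → M, IsClosedEmbedding f ∧ range f ⊆ V ∧
    interior (range f) = ∅

theorem hint_of {Z : Type*} {f : Z → X} (h : interior (range f) = ∅) :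
    ∀ z, ∀ O ∈ 𝓝 (f z), ∃ x ∈ O, x ∉ range f := by
  intro z O hO
  by_contra hc
  push Not at hc
  have : f z ∈ interior (range f) := mem_interior_iff_mem_nhds.2 (Filter.mem_of_superset hO hc)
  rw [h] at this
  exact this

theorem loc_of_emb {T : Type*} [TopologicalSpace T] [DiscreteTopology T]
    (e : X → ℕ → T) (he : IsInducing e) (e' : M → ℕ → T) (he' : IsInducing e')
    (C : Set X) (hC : IsClosed C) (hCi : interior C = ∅) (hemb : EmbEverywhere C M)
    (U : Set X) (V : Set M) (hU : IsClopen U) (hV : IsClopen V) (hVn : V.Nonempty)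
    (hUn : U.Nonempty) :
    ∃ Q : X → M → Prop, LocRel U V Q ∧ ∀ x y, x ∈ C → Q x y → DoneP Q x y := by
  by_cases hne : (C ∩ U).Nonempty
  · obtain ⟨f, hf, hfV, hfi⟩ := hemb V hV.isOpen hVn
    have : Nonempty {z : C // z.1 ∈ U} := by
      obtain ⟨x, hx⟩ := hne
      exact ⟨⟨⟨x, hx.1⟩, hx.2⟩⟩
    have hsub : IsClosedEmbedding (Subtype.val : {z : C // z.1 ∈ U} → C) :=
      (hU.isClosed.preimage continuous_subtype_val).isClosedEmbedding_subtypeVal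
    have hα : IsClosedEmbedding (fun z : {z : C // z.1 ∈ U} => z.1.1) :=
      hC.isClosedEmbedding_subtypeVal.comp hsub
    have hβ : IsClosedEmbedding (fun z : {z : C // z.1 ∈ U} => f z.1) := hf.comp hsub
    obtain ⟨Q, hQ, hd⟩ := loc_exists e he e' he' _ hα _ hβ U hU (fun z => z.2) V hV
      (fun z => hfV ⟨z.1, rfl⟩)
      (hint_of (Set.eq_empty_of_subset_empty (hCi ▸ interior_mono (by rintro _ ⟨z, rfl⟩; exact z.1.2))))
      (hint_of (Set.eq_empty_of_subset_empty (hfi ▸ interior_mono (by rintro _ ⟨z, rfl⟩; exact ⟨z.1, rfl⟩))))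
    refine ⟨Q, hQ, fun x y hx hxy => hd x y hxy (Or.inl ⟨⟨⟨x, hx⟩, (hQ.1 _ _ hxy).1⟩, rfl⟩)⟩
  · obtain ⟨x0, hx0⟩ := hUn
    obtain ⟨y0, hy0⟩ := hVn
    refine ⟨fun x y => x ∈ U ∧ y ∈ V, ⟨fun _ _ h => h, fun x hx => ⟨y0, hx, hy0⟩,
      fun y hy => ⟨x0, hx0, hy⟩, fun x y h => Or.inr ⟨U, V, hU, hV, h.1, h.2, fun _ _ _ => Iff.rfl⟩⟩,
      fun x y hx h => absurd ⟨x, hx, h.1⟩ hne⟩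

theorem flip_done {R : X → M → Prop} {x : X} {y : M} (h : DoneP (fun y x => R x y) y x) :
    DoneP R x y := ⟨h.1, h.2.2.1, h.2.1, h.2.2.2.2, h.2.2.2.1⟩

theorem flip_loc {U : Set X} {V : Set M} {R : X → M → Prop} (h : LocRel V U (fun y x => R x y)) :
    LocRel U V R := by
  obtain ⟨h1, h2, h3, h4⟩ := h
  refine ⟨fun x y h => (h1 y x h).symm, h3, h2, fun x y h => (h4 y x h).imp flip_done ?_⟩
  rintro ⟨U, V, hU, hV, hx, hy, g⟩
  exact ⟨V, U, hV, hU, hy, hx, fun x' y' h => (g y' x' h.symm).trans and_comm⟩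

theorem BF {T : Type*} [TopologicalSpace T] [DiscreteTopology T] [Nonempty X] [Nonempty M]
    (e : X → ℕ → T) (he : IsInducing e) (e' : M → ℕ → T) (he' : IsInducing e')
    (C : ℕ → Set X) (hC : ∀ n, IsClosed (C n)) (hCi : ∀ n, interior (C n) = ∅)
    (hCu : ⋃ n, C n = univ) (hemb : ∀ n, EmbEverywhere (C n) M)
    (D : ℕ → Set M) (hD : ∀ n, IsClosed (D n)) (hDi : ∀ n, interior (D n) = ∅)
    (hDu : ⋃ n, D n = univ) (hemb' : ∀ n, EmbEverywhere (D n) X) : Nonempty (X ≃ₜ M) := by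
  have step : ∀ n (R : X → M → Prop), LocRel univ univ R →
      ∃ R' : X → M → Prop, LocRel univ univ R' ∧ (∀ x y, R' x y → R x y) ∧
      ∀ x y, (x ∈ C n ∨ y ∈ D n) → R' x y → DoneP R' x y := by
    intro n R hR
    obtain ⟨R1, h1, h2, h3⟩ := step_rel (fun x _ => x ∈ C n)
      (fun U V hU hV hUn hVn =>
        loc_of_emb e he e' he' (C n) (hC n) (hCi n) (hemb n) U V hU hV hVn hUn) R hR
    obtain ⟨R2, g1, g2, g3⟩ := step_rel (fun _ y => y ∈ D n)
      (fun U V hU hV hUn hVn => by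
        obtain ⟨Q, hQ, hQd⟩ :=
          loc_of_emb e' he' e he (D n) (hD n) (hDi n) (hemb' n) V U hV hU hUn hVn
        exact ⟨fun x y => Q y x, flip_loc hQ, fun x y hy h => flip_done (hQd y x hy h)⟩) R1 h1
    refine ⟨R2, g1, fun x y h => h2 _ _ (g2 _ _ h), ?_⟩
    rintro x y (h | h) hxy
    · exact (h3 x y h (g2 _ _ hxy)).mono g2 hxy
    · exact g3 x y h hxy
  choose! nx n1 n2 n3 using step
  set R : ℕ → X → M → Prop := fun n => Nat.rec (fun _ _ => True) (fun n R => nx n R) n with hR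
  have hloc : ∀ n, LocRel univ univ (R n) := by
    intro n
    induction n with
    | zero =>
      refine ⟨fun _ _ _ => ⟨trivial, trivial⟩, fun x _ => ⟨Classical.arbitrary M, trivial⟩,
        fun x _ => ⟨Classical.arbitrary X, trivial⟩, fun x y _ => Or.inr ⟨univ, univ,
          isClopen_univ, isClopen_univ, trivial, trivial, fun _ _ _ => ?_⟩⟩
      exact ⟨fun _ => ⟨trivial, trivial⟩, fun _ => trivial⟩
    | succ n ih => exact n1 n _ ih
  refine homeo_of_rels R hloc (fun n => n2 n _ (hloc n)) (fun x => ?_) (fun y => ?_)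
  · obtain ⟨n, hn⟩ := mem_iUnion.1 (hCu ▸ mem_univ x : x ∈ ⋃ n, C n)
    exact ⟨n + 1, fun y h => n3 n _ (hloc n) x y (Or.inl hn) h⟩
  · obtain ⟨n, hn⟩ := mem_iUnion.1 (hDu ▸ mem_univ y : y ∈ ⋃ n, D n)
    exact ⟨n + 1, fun x h => n3 n _ (hloc n) x y (Or.inr hn) h⟩
end BF



/-! ### The embedding scheme -/

section Scheme

variable {T : Type*} [TopologicalSpace T] [DiscreteTopology T]

theorem isClopen_cyl (n : ℕ) (x : ℕ → T) : IsClopen {y | ag n y x} := by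
  apply isClopen_of_loc
  intro y
  filter_upwards [ev_ag (IsInducing.id) y n] with z hz
  exact ⟨fun h => hz.symm.trans h, fun h => hz.trans h⟩

/-- The abstract hypotheses of the embedding scheme. -/
structure SchemeHyp (F : ℕ → ℕ → Set (ℕ → T)) (Pf : ℕ → Set (ℕ → T) → Prop) : Prop where
  closed : ∀ m j, IsClosed (F m j)
  mono : ∀ m, Monotone (F m)
  anti : ∀ m x, (∃ j, x ∈ F (m + 1) j) → ∃ j, x ∈ F m j
  next : ∀ m P U, Pf m P → IsOpen U → (P ∩ U).Nonempty →
    ∃ j m' P', m < m' ∧ Pf m' P' ∧ P' ⊆ P ∧ P' ⊆ U ∧ P' ⊆ F m j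
  nonempty : ∀ m P, Pf m P → P.Nonempty
  codense : ∀ m P U j, Pf m P → IsOpen U → (P ∩ U).Nonempty → ∃ y ∈ P, y ∈ U ∧ y ∉ F m j
  split : ∀ m P U, Pf m P → IsOpen U → (P ∩ U).Nonempty →
    ∃ v : T → Set (ℕ → T), (∀ t, IsOpen (v t)) ∧ (∀ t, v t ⊆ U) ∧ (∀ t, (P ∩ v t).Nonempty) ∧
      DiscreteFamily v

/-- The state of the construction. -/
structure StS (T : Type*) where
  U : Set (ℕ → T)
  P : ℕ → Set (ℕ → T)
  m : ℕ → ℕ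
  j : ℕ → ℕ

/-- Validity of a state. -/
structure StS.Valid (F : ℕ → ℕ → Set (ℕ → T)) (Pf : ℕ → Set (ℕ → T) → Prop) (σ : StS T) : Prop where
  clopen : IsClopen σ.U
  hP : ∀ i, Pf (σ.m i) (σ.P i)
  dec : ∀ i, σ.P (i + 1) ⊆ σ.P i
  sub : ∀ i, σ.P (i + 1) ⊆ F (σ.m i) (σ.j i)
  lt : ∀ i, σ.m i < σ.m (i + 1)
  ne : ∀ i, (σ.P i ∩ σ.U).Nonempty

variable {F : ℕ → ℕ → Set (ℕ → T)} {Pf : ℕ → Set (ℕ → T) → Prop}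

theorem chain_exists (H : SchemeHyp F Pf) (m : ℕ) (P U : Set (ℕ → T)) (hP : Pf m P)
    (hU : IsClopen U) (hne : (P ∩ U).Nonempty) :
    ∃ σ : StS T, σ.Valid F Pf ∧ σ.U = U ∧ σ.P 0 = P ∧ σ.m 0 = m := by
  have key : ∀ s : {s : ℕ × Set (ℕ → T) // Pf s.1 s.2 ∧ (s.2 ∩ U).Nonempty},
      ∃ s' : {s : ℕ × Set (ℕ → T) // Pf s.1 s.2 ∧ (s.2 ∩ U).Nonempty}, ∃ j,
        s.1.1 < s'.1.1 ∧ s'.1.2 ⊆ s.1.2 ∧ s'.1.2 ⊆ F s.1.1 j := by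
    rintro ⟨⟨m, P⟩, h1, h2⟩
    obtain ⟨j, m', P', a, b, c, d, e⟩ := H.next m P U h1 hU.isOpen h2
    obtain ⟨y, hy⟩ := H.nonempty _ _ b
    exact ⟨⟨⟨m', P'⟩, b, ⟨y, hy, d hy⟩⟩, j, a, c, e⟩
  choose nx jj h1 h2 h3 using key
  let s : ℕ → {s : ℕ × Set (ℕ → T) // Pf s.1 s.2 ∧ (s.2 ∩ U).Nonempty} :=
    fun n => Nat.rec ⟨⟨m, P⟩, hP, hne⟩ (fun _ s => nx s) n
  refine ⟨⟨U, fun i => (s i).1.2, fun i => (s i).1.1, fun i => jj (s i)⟩, ?_, rfl, rfl, rfl⟩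
  exact ⟨hU, fun i => (s i).2.1, fun i => h2 (s i), fun i => h3 (s i), fun i => h1 (s i),
    fun i => (s i).2.2⟩

theorem StS.Valid.anti {σ : StS T} (h : σ.Valid F Pf) : Antitone σ.P :=
  antitone_nat_of_succ_le h.dec

theorem rebuild (H : SchemeHyp F Pf) (σ : StS T) (h : σ.Valid F Pf) (r : ℕ) (w : Set (ℕ → T))
    (hw : IsClopen w) (hne : (σ.P r ∩ w).Nonempty) :
    ∃ σ' : StS T, σ'.Valid F Pf ∧ σ'.U = w ∧ (∀ i ≤ r, σ'.P i = σ.P i ∧ σ'.m i = σ.m i) ∧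
      ∀ i < r, σ'.j i = σ.j i := by
  obtain ⟨τ, hτ, h1, h2, h3⟩ := chain_exists H (σ.m r) (σ.P r) w (h.hP r) hw hne
  refine ⟨⟨w, fun i => if i ≤ r then σ.P i else τ.P (i - r),
    fun i => if i ≤ r then σ.m i else τ.m (i - r),
    fun i => if i < r then σ.j i else τ.j (i - r)⟩, ?_, rfl, ?_, ?_⟩
  · refine ⟨hw, ?_, ?_, ?_, ?_, ?_⟩
    · intro i
      by_cases hi : i ≤ r
      · simp only [hi, if_true]; exact h.hP i
      · simp only [hi, if_false]; exact hτ.hP _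
    · intro i
      rcases lt_trichotomy i r with hi | rfl | hi
      · simp only [hi.le, Nat.succ_le_of_lt hi, if_true]; exact h.dec i
      · simp only [le_refl, if_true, Nat.not_succ_le_self, if_false]
        rw [Nat.add_sub_cancel_left, ← h2]; exact hτ.dec 0
      · simp only [not_le.2 hi, not_le.2 (Nat.lt_succ_of_lt hi), if_false]
        rw [Nat.succ_sub hi.le]; exact hτ.dec _
    · intro i
      rcases lt_trichotomy i r with hi | rfl | hi
      · simp only [hi, hi.le, Nat.succ_le_of_lt hi, if_true]; exact h.sub i
      · simp only [le_refl, lt_irrefl, if_true, Nat.not_succ_le_self, if_false]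
        rw [Nat.add_sub_cancel_left, Nat.sub_self, ← h3]; exact hτ.sub 0
      · simp only [not_le.2 hi, not_lt.2 hi.le, not_le.2 (Nat.lt_succ_of_lt hi), if_false]
        rw [Nat.succ_sub hi.le]; exact hτ.sub _
    · intro i
      rcases lt_trichotomy i r with hi | rfl | hi
      · simp only [hi.le, Nat.succ_le_of_lt hi, if_true]; exact h.lt i
      · simp only [le_refl, if_true, Nat.not_succ_le_self, if_false]
        rw [Nat.add_sub_cancel_left, ← h3]; exact hτ.lt 0
      · simp only [not_le.2 hi, not_le.2 (Nat.lt_succ_of_lt hi), if_false]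
        rw [Nat.succ_sub hi.le]; exact hτ.lt _
    · intro i
      by_cases hi : i ≤ r
      · simp only [hi, if_true]; exact hne.mono (inter_subset_inter_left _ (h.anti hi))
      · simp only [hi, if_false]; have := hτ.ne (i - r); rwa [h1] at this
  · intro i hi; simp [hi]
  · intro i hi; simp [hi]

theorem step_exists (H : SchemeHyp F Pf) (σ : StS T) (n : ℕ) (h : σ.Valid F Pf) :
    ∃ (V : T → Set (ℕ → T)) (nx : T → ℕ → StS T), DiscreteFamily V ∧ (∀ t, V t ⊆ σ.U) ∧
      ∀ t r, r ≤ n → (nx t r).Valid F Pf ∧ (nx t r).U ⊆ V t ∧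
        (∀ y ∈ (nx t r).U, ∀ z ∈ (nx t r).U, ag (n + 1) y z) ∧
        (∀ y ∈ (nx t r).U, y ∉ F (σ.m r) n) ∧
        (∀ i ≤ r, (nx t r).P i = σ.P i ∧ (nx t r).m i = σ.m i) ∧
        ∀ i < r, (nx t r).j i = σ.j i := by
  obtain ⟨V, h1, h2, h3, h4⟩ := H.split _ _ σ.U (h.hP n) h.clopen.isOpen (h.ne n)
  have key : ∀ t r, ∃ τ : StS T, r ≤ n → (τ).Valid F Pf ∧ (τ).U ⊆ V t ∧
        (∀ y ∈ (τ).U, ∀ z ∈ (τ).U, ag (n + 1) y z) ∧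
        (∀ y ∈ (τ).U, y ∉ F (σ.m r) n) ∧
        (∀ i ≤ r, (τ).P i = σ.P i ∧ (τ).m i = σ.m i) ∧
        ∀ i < r, (τ).j i = σ.j i := by
    intro t r
    by_cases hr : r ≤ n
    swap
    · exact ⟨σ, fun h => absurd h hr⟩
    obtain ⟨y, hy1, hy2, hy3⟩ := H.codense _ _ (V t) n (h.hP r) (h1 t)
      ((h3 t).mono (inter_subset_inter_left _ (h.anti hr)))
    have : V t ∩ (F (σ.m r) n)ᶜ ∈ 𝓝 y :=
      Filter.inter_mem ((h1 t).mem_nhds hy2) ((H.closed _ _).isOpen_compl.mem_nhds hy3)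
    obtain ⟨N, hN⟩ := nhds_seq.1 this
    obtain ⟨τ, a, b, c, d⟩ := rebuild H σ h r {z | ag (max N (n + 1)) z y} (isClopen_cyl _ _)
      ⟨y, hy1, ag.refl _ _⟩
    refine ⟨τ, fun _ => ⟨a, ?_, ?_, ?_, c, d⟩⟩ <;> rw [b]
    · exact fun z hz => (hN z (ag.mono hz (le_max_left _ _))).1
    · exact fun z hz z' hz' =>
        (ag.mono hz (le_max_right _ _)).trans (ag.mono hz' (le_max_right _ _)).symm
    · exact fun z hz => (hN z (ag.mono hz (le_max_left _ _))).2
  choose nx hnx using key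
  exact ⟨V, nx, h4, h2, hnx⟩

theorem scheme (H : SchemeHyp F Pf) (r : (ℕ → T) → ℕ → ℕ) (hr : ∀ x n, r x n ≤ n)
    (hrd : ∀ n x y, ag (n + 1) x y → r x n = r y n) (m0 : ℕ) (P0 U0 : Set (ℕ → T))
    (hP0 : Pf m0 P0) (hU0 : IsClopen U0) (hne : (P0 ∩ U0).Nonempty) :
    ∃ φ : (ℕ → T) → (ℕ → T), IsClosedEmbedding φ ∧ (∀ x, φ x ∈ U0) ∧
      ∀ x, (∀ m, ∃ j, φ x ∈ F m j) ↔ Tendsto (r x) atTop atTop := by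
  obtain ⟨σ0, v0, u0, -, -⟩ := chain_exists H m0 P0 U0 hP0 hU0 hne
  choose! V nx hVd hVs hnx using fun σ : StS T => fun n => step_exists H σ n
  let st : (ℕ → T) → ℕ → StS T := fun x n => Nat.rec σ0 (fun n σ => nx σ n (x n) (r x n)) n
  have st0 : ∀ x, st x 0 = σ0 := fun x => rfl
  have sts : ∀ x n, st x (n + 1) = nx (st x n) n (x n) (r x n) := fun x n => rfl
  have stv : ∀ x n, (st x n).Valid F Pf := by
    intro x n
    induction n with
    | zero => exact v0
    | succ n ih => rw [sts]; exact (hnx _ n ih _ _ (hr x n)).1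
  have hst := fun x n => hnx (st x n) n (stv x n) (x n) (r x n) (hr x n)
  simp only [← sts] at hst
  have std : ∀ n x y, ag n x y → st x n = st y n := by
    intro n
    induction n with
    | zero => intro x y _; rfl
    | succ n ih =>
      intro x y h
      rw [sts, sts, ih x y (h.mono n.le_succ), h n n.lt_succ_self, hrd n x y h]
  have Usub : ∀ x n, (st x (n + 1)).U ⊆ (st x n).U := fun x n =>
    (hst x n).2.1.trans (hVs _ n (stv x n) _)
  have Uanti : ∀ x, Antitone fun n => (st x n).U := fun x => antitone_nat_of_succ_le (Usub x)
  have Ucyl : ∀ x n, ∀ y ∈ (st x n).U, ∀ z ∈ (st x n).U, ag n y z := by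
    intro x n
    cases n with
    | zero => intro y _ z _; exact ag.zero _ _
    | succ n => exact (hst x n).2.2.1
  have Une : ∀ x n, ∃ y, y ∈ (st x n).U := fun x n => ((stv x n).ne 0).imp fun y h => h.2
  choose y hy using Une
  let φ : (ℕ → T) → (ℕ → T) := fun x i => y x (i + 1) i
  have φag : ∀ x n, ag n (φ x) (y x n) := fun x n i hi =>
    Ucyl x (i + 1) _ (hy x (i + 1)) _ (Uanti x (Nat.succ_le_of_lt hi) (hy x n)) i i.lt_succ_self
  have φlim : ∀ x (C : Set (ℕ → T)), IsClosed C → (∀ n, ∃ z ∈ C, ag n (φ x) z) → φ x ∈ C := by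
    intro x C hC h
    by_contra hc
    obtain ⟨n, hn⟩ := nhds_seq.1 (hC.isOpen_compl.mem_nhds hc)
    obtain ⟨z, hz, ha⟩ := h n
    exact hn z ha.symm hz
  have φU : ∀ x n, φ x ∈ (st x n).U := by
    intro x n
    refine φlim x _ (stv x n).clopen.isClosed fun N => ⟨y x (max n N), ?_, ?_⟩
    · exact Uanti x (le_max_left _ _) (hy x _)
    · exact (φag x _).mono (le_max_right _ _)
  have φcont : Continuous φ := by
    refine continuous_iff_continuousAt.2 fun x O hO => ?_
    obtain ⟨n, hn⟩ := nhds_seq.1 hO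
    show ∀ᶠ z in 𝓝 x, φ z ∈ O
    filter_upwards [ev_ag IsInducing.id x n] with z hz
    refine hn _ (Ucyl x n _ ?_ _ (φU x n))
    rw [← std n z x hz]; exact φU z n
  have φV : ∀ x n, φ x ∈ V (st x n) n (x n) := fun x n => (hst x n).2.1 (φU x (n + 1))
  have disj : ∀ σ n, σ.Valid F Pf → ∀ z s t, z ∈ V σ n s → z ∈ V σ n t → s = t := by
    intro σ n hσ z s t hs ht
    obtain ⟨O, hO, hO'⟩ := hVd σ n hσ z
    exact hO' ⟨z, hs, mem_of_mem_nhds hO⟩ ⟨z, ht, mem_of_mem_nhds hO⟩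
  have back : ∀ n x z, φ z ∈ (st x n).U → ag n z x := by
    intro n
    induction n with
    | zero => intro x z _; exact ag.zero _ _
    | succ n ih =>
      intro x z hz
      have h1 := ih x z (Usub x n hz)
      intro i hi
      rcases Nat.lt_succ_iff_lt_or_eq.1 hi with hi | rfl
      · exact h1 i hi
      · have a := φV z i
        rw [std i z x h1] at a
        exact disj _ _ (stv x i) _ _ _ a ((hst x i).2.1 hz)
  have φind : IsInducing φ := by
    refine isInducing_iff_nhds.2 fun x => le_antisymm φcont.continuousAt.le_comap ?_
    intro O hO
    obtain ⟨n, hn⟩ := nhds_seq.1 hO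
    exact ⟨(st x n).U, (stv x n).clopen.isOpen.mem_nhds (φU x n), fun z hz => hn z (back n x z hz)⟩
  have φinj : Function.Injective φ := by
    intro a b hab
    funext i
    exact back (i + 1) b a (hab ▸ φU b (i + 1)) i i.lt_succ_self
  have φcl : IsClosed (range φ) := by
    refine isClosed_of_closure_subset fun z hz => ?_
    have hL : (comap φ (𝓝 z)).NeBot := by
      rw [comap_neBot_iff_frequently]
      exact (mem_closure_iff_frequently.1 hz)
    have key : ∀ n, ∃ x, ∀ᶠ y in comap φ (𝓝 z), ag n y x := by
      intro n
      induction n with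
      | zero => exact ⟨z, Eventually.of_forall fun y => ag.zero _ _⟩
      | succ n ih =>
        obtain ⟨x, hx⟩ := ih
        obtain ⟨O, hO, hO'⟩ := hVd (st x n) n (stv x n) z
        have hev := hx.and (preimage_mem_comap hO)
        obtain ⟨y0, h0, h0'⟩ := hev.exists
        refine ⟨y0, ?_⟩
        filter_upwards [hev] with y hy
        intro i hi
        rcases Nat.lt_succ_iff_lt_or_eq.1 hi with hi | rfl
        · exact (hy.1.trans h0.symm) i hi
        · refine hO' ⟨φ y, ?_, hy.2⟩ ⟨φ y0, ?_, h0'⟩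
          · rw [← std i _ _ hy.1]; exact φV y i
          · rw [← std i _ _ h0]; exact φV y0 i
    choose x hx using key
    have hx' : ∀ n, ag n (x n) (fun i => x (i + 1) i) := by
      intro n i hi
      obtain ⟨y, h1, h2⟩ := ((hx n).and (hx (i + 1))).exists
      exact (h1 i hi).symm.trans (h2 i i.lt_succ_self)
    have hle : comap φ (𝓝 z) ≤ 𝓝 (fun i => x (i + 1) i) := by
      intro O hO
      obtain ⟨n, hn⟩ := nhds_seq.1 hO
      filter_upwards [hx n] with y hy using hn y (hy.trans (hx' n))
    have t1 : Tendsto φ (comap φ (𝓝 z)) (𝓝 (φ fun i => x (i + 1) i)) :=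
      (φcont.tendsto _).mono_left hle
    exact ⟨_, tendsto_nhds_unique t1 tendsto_comap⟩
  refine ⟨φ, ⟨⟨φind, φinj⟩, φcl⟩, fun x => u0 ▸ φU x 0, fun x => ?_⟩
  have hanti : ∀ m i z, (∃ j, z ∈ F (m + i) j) → ∃ j, z ∈ F m j := by
    intro m i z
    induction i with
    | zero => exact id
    | succ i ih => exact fun h => ih (H.anti _ _ h)
  have stab : ∀ N i, (∀ n ≥ N, i ≤ r x n) → ∀ d, (st x (N + d)).P i = (st x N).P i ∧
      (st x (N + d)).m i = (st x N).m i := by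
    intro N i h d
    induction d with
    | zero => exact ⟨rfl, rfl⟩
    | succ d ih =>
      have := (hst x (N + d)).2.2.2.2.1 i (h _ (by omega))
      exact ⟨this.1.trans ih.1, this.2.trans ih.2⟩
  constructor
  · intro h
    by_contra hc
    have hex : ∃ b, ∃ᶠ n in atTop, r x n ≤ b := by
      rw [tendsto_atTop] at hc
      push Not at hc
      obtain ⟨b, hb⟩ := hc
      exact ⟨b, hb.mono fun n h => h.le⟩
    classical
    set i := Nat.find hex with hi
    have h1 := Nat.find_spec hex
    rw [← hi] at h1
    have h2 : ∀ᶠ n in atTop, i ≤ r x n := by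
      rcases Nat.eq_zero_or_pos i with h0 | h0
      · rw [h0]; exact Eventually.of_forall fun n => Nat.zero_le _
      · have := Nat.find_min hex (m := i - 1) (by omega)
        rw [not_frequently] at this
        filter_upwards [this] with n hn
        omega
    obtain ⟨N, hN⟩ := eventually_atTop.1 h2
    obtain ⟨j, hj⟩ := h ((st x N).m i)
    obtain ⟨n, hn, hn'⟩ := (frequently_atTop.1 h1) (max N j)
    have e : r x n = i := le_antisymm hn' (hN n (le_trans (le_max_left _ _) hn))
    obtain ⟨d, rfl⟩ := Nat.exists_eq_add_of_le (le_trans (le_max_left _ _) hn)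
    have := (hst x (N + d)).2.2.2.1 (φ x) (φU x (N + d + 1))
    rw [e, (stab N i hN d).2] at this
    exact this (H.mono _ (le_trans (le_max_right _ _) hn) hj)
  · intro h i
    obtain ⟨N, hN⟩ := eventually_atTop.1 (h.eventually (eventually_ge_atTop (i + 1)))
    have hmi : i ≤ (st x N).m i := (strictMono_nat_of_lt_succ (stv x N).lt).id_le i
    obtain ⟨d, hd⟩ := Nat.exists_eq_add_of_le hmi
    refine hanti i d _ ⟨(st x N).j i, ?_⟩
    rw [← hd]
    refine φlim x _ (H.closed _ _) fun n => ?_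
    obtain ⟨z, hz, hz'⟩ := (stv x (N + n)).ne (i + 1)
    rw [(stab N (i + 1) hN n).1] at hz
    exact ⟨z, (stv x N).sub i hz, Ucyl x n _ (φU x n) _ (Uanti x (Nat.le_add_left _ _) hz')⟩

end Scheme



section NormalForm

variable {T : Type*} [TopologicalSpace T] [DiscreteTopology T]

theorem IsFsigmaSet.mono_form {Y : Type*} [TopologicalSpace Y] {s : Set Y} (h : IsFsigmaSet s) :
    ∃ C : ℕ → Set Y, (∀ j, IsClosed (C j)) ∧ Monotone C ∧ s = ⋃ j, C j := by
  obtain ⟨F, hF, rfl⟩ := h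
  refine ⟨fun j => ⋃ i ∈ Set.Iic j, F i, fun j => (Set.finite_Iic j).isClosed_biUnion fun i _ => hF i,
    fun a b hab => Set.biUnion_subset_biUnion_left (Set.Iic_subset_Iic.2 hab), ?_⟩
  ext y
  simp only [mem_iUnion, mem_Iic]
  exact ⟨fun ⟨i, hi⟩ => ⟨i, i, le_rfl, hi⟩, fun ⟨_, i, _, hi⟩ => ⟨i, hi⟩⟩

theorem IsFsigmaDelta.preimage {Y Z : Type*} [TopologicalSpace Y] [TopologicalSpace Z] {s : Set Y}
    (h : IsFsigmaDelta s) {f : Z → Y} (hf : Continuous f) : IsFsigmaDelta (f ⁻¹' s) := by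
  obtain ⟨F, hF, rfl⟩ := h
  refine ⟨fun n => f ⁻¹' F n, fun n => ?_, preimage_iInter⟩
  obtain ⟨C, hC, h⟩ := hF n
  exact ⟨fun j => f ⁻¹' C j, fun j => (hC j).preimage hf, by dsimp only; rw [h, preimage_iUnion]⟩

theorem IsGdeltaSigma.compl {Y : Type*} [TopologicalSpace Y] {s : Set Y}
    (h : IsGdeltaSigma s) : IsFsigmaDelta sᶜ := by
  obtain ⟨G, hG, rfl⟩ := h
  refine ⟨fun n => (G n)ᶜ, fun n => ?_, by simp⟩
  obtain ⟨f, hf, h⟩ := isGδ_iff_eq_iInter_nat.1 (hG n)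
  exact ⟨fun j => (f j)ᶜ, fun j => (hf j).isClosed_compl, by dsimp only; rw [h, compl_iInter]⟩

/-- The counting function attached to an increasing sequence of closed sets. -/
noncomputable def cnt (C : ℕ → Set (ℕ → T)) (x : ℕ → T) (n : ℕ) : ℕ :=
  sInf {j | n ≤ j ∨ ∃ z ∈ C j, ag n z x}

theorem cnt_congr (C : ℕ → Set (ℕ → T)) {x y : ℕ → T} {n : ℕ} (h : ag n x y) :
    cnt C x n = cnt C y n := by
  unfold cnt
  congr 1
  ext j
  exact or_congr_right (exists_congr fun z => and_congr_right fun _ =>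
    ⟨fun h' => h'.trans h, fun h' => h'.trans h.symm⟩)

theorem cnt_mono (C : ℕ → Set (ℕ → T)) (x : ℕ → T) : Monotone (cnt C x) := by
  refine monotone_nat_of_le_succ fun n => ?_
  have : {j | n + 1 ≤ j ∨ ∃ z ∈ C j, ag (n + 1) z x}.Nonempty := ⟨n + 1, Or.inl le_rfl⟩
  refine Nat.sInf_le ?_
  rcases Nat.sInf_mem this with h | ⟨z, hz, h⟩
  · exact Or.inl (Nat.le_of_succ_le h)
  · exact Or.inr ⟨z, hz, h.mono n.le_succ⟩

theorem cnt_iff (C : ℕ → Set (ℕ → T)) (hC : ∀ j, IsClosed (C j)) (hm : Monotone C) (x : ℕ → T) :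
    (∃ j, x ∈ C j) ↔ ∀ᶠ n in atTop, cnt C x (n + 1) = cnt C x n := by
  constructor
  · rintro ⟨j, hj⟩
    have hb : ∀ n, cnt C x n ≤ j := fun n => Nat.sInf_le (Or.inr ⟨x, hj, ag.refl _ _⟩)
    have : ∃ N, ∀ n, cnt C x n ≤ cnt C x N := by
      have hbd : BddAbove (range (cnt C x)) := ⟨j, by rintro _ ⟨n, rfl⟩; exact hb n⟩
      obtain ⟨N, hN⟩ := Nat.sSup_mem (range_nonempty (cnt C x)) hbd
      exact ⟨N, fun n => hN ▸ le_csSup hbd ⟨n, rfl⟩⟩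
    obtain ⟨N, hN⟩ := this
    filter_upwards [eventually_ge_atTop N] with n hn
    exact le_antisymm ((hN _).trans (cnt_mono C x hn)) (cnt_mono C x n.le_succ)
  · intro h
    obtain ⟨N, hN⟩ := eventually_atTop.1 h
    have hc : ∀ d, cnt C x (N + d) = cnt C x N := by
      intro d
      induction d with
      | zero => rfl
      | succ d ih => rw [← ih]; exact hN _ (Nat.le_add_right _ _)
    set j := cnt C x N
    refine ⟨j, ?_⟩
    by_contra hx
    obtain ⟨n, hn⟩ := nhds_seq.1 ((hC j).isOpen_compl.mem_nhds hx)
    have hne : {i | N + (n + j + 1) ≤ i ∨ ∃ z ∈ C i, ag (N + (n + j + 1)) z x}.Nonempty :=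
      ⟨_, Or.inl le_rfl⟩
    have := Nat.sInf_mem hne
    have e : sInf {i | N + (n + j + 1) ≤ i ∨ ∃ z ∈ C i, ag (N + (n + j + 1)) z x} = j := hc _
    rw [e] at this
    rcases this with h | ⟨z, hz, h⟩
    · omega
    · exact hn z (h.mono (by omega)) hz

theorem normal_form {W : Set (ℕ → T)} (hW : IsFsigmaDelta W) :
    ∃ r : (ℕ → T) → ℕ → ℕ, (∀ x n, r x n ≤ n) ∧
      (∀ n x y, ag (n + 1) x y → r x n = r y n) ∧ ∀ x, Tendsto (r x) atTop atTop ↔ x ∈ W := by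
  obtain ⟨F, hF, rfl⟩ := hW
  choose C hC hm he using fun n => (hF n).mono_form
  refine ⟨fun x n => sInf {i | n ≤ i ∨ cnt (C i) x (n + 1) ≠ cnt (C i) x n}, ?_, ?_, ?_⟩
  · exact fun x n => Nat.sInf_le (Or.inl le_rfl)
  · intro n x y h
    dsimp only
    congr 1
    ext i
    simp only [mem_ofPred_eq, cnt_congr (C i) h, cnt_congr (C i) (h.mono n.le_succ)]
  · intro x
    have : x ∈ ⋂ n, F n ↔ ∀ i, ∀ᶠ n in atTop, cnt (C i) x (n + 1) = cnt (C i) x n := by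
      simp only [mem_iInter]
      refine forall_congr' fun i => ?_
      rw [he i, mem_iUnion, cnt_iff (C i) (hC i) (hm i)]
    rw [this, tendsto_atTop]
    constructor
    · intro h i
      filter_upwards [h (i + 1)] with n hn
      by_contra hc
      have := Nat.sInf_le (show i ∈ {i | n ≤ i ∨ cnt (C i) x (n + 1) ≠ cnt (C i) x n} from Or.inr hc)
      omega
    · intro h b
      have : ∀ᶠ n in atTop, ∀ i ∈ Set.Iio b, cnt (C i) x (n + 1) = cnt (C i) x n :=
        (eventually_all_finite (Set.finite_Iio b)).2 fun i _ => h i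
      filter_upwards [this, eventually_ge_atTop b] with n h1 h2
      refine le_csInf ⟨n, Or.inl le_rfl⟩ ?_
      rintro i (hi | hi)
      · omega
      · by_contra hc
        exact hi (h1 i (not_le.1 hc))

/-- Interleaving with a constant sequence. -/
def ileave (t0 : T) (x : ℕ → T) : ℕ → T := fun n => if n % 2 = 0 then x (n / 2) else t0

/-- Every `G_δσ` space embeds everywhere in the complement of a set satisfying the
scheme hypotheses. -/
theorem embEverywhere_of_scheme [Nontrivial T] {F : ℕ → ℕ → Set (ℕ → T)}
    {Pf : ℕ → Set (ℕ → T) → Prop} (H : SchemeHyp F Pf)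
    {X Z : Type*} [TopologicalSpace X] [TopologicalSpace Z] (e : X → ℕ → T) (he : IsEmbedding e)
    (hran : ∀ y, y ∈ range e ↔ ¬ ∀ m, ∃ j, y ∈ F m j)
    (hstart : ∀ U, IsOpen U → (U ∩ range e).Nonempty → ∃ m P, Pf m P ∧ P ⊆ U)
    (i : Z → ℕ → T) (hi : IsEmbedding i) (hZ : IsGdeltaSigma (range i)) : EmbEverywhere Z X := by
  obtain ⟨t0, t1, ht⟩ := exists_pair_ne T
  intro V hV ⟨x0, hx0⟩
  obtain ⟨n, hn⟩ := (nhds_ind he.isInducing).1 (hV.mem_nhds hx0)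
  obtain ⟨m, P, hP, hPU⟩ := hstart {y | ag n y (e x0)} (isClopen_cyl _ _).isOpen
    ⟨e x0, ag.refl _ _, x0, rfl⟩
  have hPne : (P ∩ {y | ag n y (e x0)}).Nonempty := by
    obtain ⟨y, hy⟩ := H.nonempty _ _ hP
    exact ⟨y, hy, hPU hy⟩
  have hev : Continuous (fun (x : ℕ → T) (k : ℕ) => x (2 * k)) := by fun_prop
  obtain ⟨r, hr, hrd, hrW⟩ := normal_form (hZ.compl.preimage hev)
  obtain ⟨φ, hφ, hφU, hφW⟩ := scheme H r hr hrd m P _ hP (isClopen_cyl n (e x0)) hPne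
  have key : ∀ x, φ x ∈ range e ↔ (fun k => x (2 * k)) ∈ range i := by
    intro x
    rw [hran, hφW, hrW]
    simp
  have Jl : ∀ x, (fun k => ileave t0 x (2 * k)) = x := by
    intro x; funext k; simp [ileave]
  have Jc : Continuous (ileave t0 : (ℕ → T) → ℕ → T) := by
    refine continuous_pi fun n => ?_
    unfold ileave
    split_ifs <;> fun_prop
  have Jemb : IsEmbedding (ileave t0 : (ℕ → T) → ℕ → T) :=
    Topology.IsEmbedding.of_leftInverse (f := fun (x : ℕ → T) (k : ℕ) => x (2 * k)) Jl hev Jc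
  have hex : ∀ z, ∃ y, e y = φ (ileave t0 (i z)) := fun z =>
    (key _).2 (by rw [Jl]; exact ⟨z, rfl⟩)
  choose f hf using hex
  have hfe : e ∘ f = φ ∘ ileave t0 ∘ i := funext hf
  have femb : IsEmbedding f := by
    have h1 : IsEmbedding (e ∘ f) := by
      rw [hfe]; exact hφ.isEmbedding.comp (Jemb.comp hi)
    exact ⟨(he.isInducing.of_comp_iff).1 h1.isInducing, h1.injective.of_comp⟩
  have hodd : ∀ x : ℕ → T, (∀ k, x (2 * k + 1) = t0) → ileave t0 (fun k => x (2 * k)) = x := by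
    intro x hx
    funext k
    unfold ileave
    rcases Nat.even_or_odd' k with ⟨l, rfl | rfl⟩
    · simp
    · rw [if_neg (by omega), hx]
  have frange : range f = e ⁻¹' (φ '' {x | ∀ k, x (2 * k + 1) = t0}) := by
    ext y
    constructor
    · rintro ⟨z, rfl⟩
      refine ⟨_, ?_, (hf z).symm⟩
      intro k
      unfold ileave
      rw [if_neg (by omega)]
    · rintro ⟨x, hx, hxy⟩
      obtain ⟨z, hz⟩ := (key x).1 ⟨y, hxy.symm⟩
      refine ⟨z, he.injective ?_⟩
      rw [hf, hz, hodd x hx, hxy]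
  have hcl : IsClosed {x : ℕ → T | ∀ k, x (2 * k + 1) = t0} := by
    simp only [ofPred_forall]
    exact isClosed_iInter fun k => isClosed_eq (by fun_prop) continuous_const
  refine ⟨f, ⟨femb, ?_⟩, ?_, ?_⟩
  · rw [frange]
    exact (hφ.isClosedMap _ hcl).preimage he.continuous
  · rintro _ ⟨z, rfl⟩
    refine hn _ ?_
    rw [hf]; exact hφU _
  · by_contra hc
    obtain ⟨y, hy⟩ := nonempty_iff_ne_empty.2 hc
    obtain ⟨z, rfl⟩ := interior_subset hy
    obtain ⟨N, hN⟩ := (nhds_ind he.isInducing).1 (mem_interior_iff_mem_nhds.1 hy)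
    have h1 : ∀ᶠ x in 𝓝 (ileave t0 (i z)), ag N (φ x) (e (f z)) := by
      rw [hf]
      exact (hφ.continuous.tendsto _).eventually (ev_ag IsInducing.id _ N)
    obtain ⟨M, hM⟩ := nhds_seq.1 h1
    set x : ℕ → T := Function.update (ileave t0 (i z)) (2 * M + 1) t1 with hx
    have hxM : ag M x (ileave t0 (i z)) := by
      intro k hk
      rw [hx, Function.update_of_ne (by omega)]
    have hxe : (fun k => x (2 * k)) = i z := by
      rw [← Jl (i z)]
      funext k
      rw [hx, Function.update_of_ne (by omega)]
    obtain ⟨y, hy⟩ := (key x).2 ⟨z, hxe.symm⟩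
    have hyr : y ∈ range f := hN y (by rw [hy]; exact hM x hxM)
    rw [frange] at hyr
    obtain ⟨x', hx', hxy⟩ := hyr
    have : x' = x := hφ.injective (hxy.trans hy)
    have h3 := hx' M
    rw [this, hx, Function.update_self] at h3
    exact ht h3.symm

end NormalForm



section Split

variable {T : Type u} [TopologicalSpace T] [DiscreteTopology T]

/-- `E` has a dense-in-closure set of size `< k`. -/
def Tiny (k : Cardinal.{u}) (E : Set (ℕ → T)) : Prop :=
  ∃ D : Set (ℕ → T), Cardinal.mk D < k ∧ E ⊆ closure D

theorem Tiny.mono {k : Cardinal.{u}} {E E' : Set (ℕ → T)} (h : Tiny k E) (hE : E' ⊆ E) :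
    Tiny k E' := by
  obtain ⟨D, h1, h2⟩ := h
  exact ⟨D, h1, hE.trans h2⟩

theorem discrete_cyl {ι : Type*} (n0 : ℕ) (a : ι → ℕ → T) (n : ι → ℕ) (hn : ∀ s, n0 ≤ n s)
    (h1 : ∀ s t, ag n0 (a s) (a t) → n s = n t) (h2 : ∀ s t, ag (n s) (a s) (a t) → s = t) :
    DiscreteFamily fun s => {y | ag (n s) y (a s)} := by
  intro x
  by_cases hx : ∃ s, ag n0 (a s) x
  · obtain ⟨s, hs⟩ := hx
    refine ⟨{y | ag (n s) y x}, (isClopen_cyl _ _).isOpen.mem_nhds (ag.refl _ _), ?_⟩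
    have key : ∀ t, t ∈ {i | ({y | ag (n i) y (a i)} ∩ {y | ag (n s) y x}).Nonempty} →
        n t = n s ∧ ag (n s) (a t) x := by
      rintro t ⟨y, hy, hy'⟩
      have e : n t = n s := h1 t s
        (((ag.mono hy (hn t)).symm.trans (ag.mono hy' (hn s))).trans hs.symm)
      refine ⟨e, ?_⟩
      rw [mem_ofPred_eq, e] at hy
      exact hy.symm.trans hy'
    intro t ht t' ht'
    obtain ⟨e, h⟩ := key t ht
    obtain ⟨e', h'⟩ := key t' ht'
    exact h2 t t' (by rw [e]; exact h.trans h'.symm)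
  · refine ⟨{y | ag n0 y x}, (isClopen_cyl _ _).isOpen.mem_nhds (ag.refl _ _), ?_⟩
    rintro t ⟨y, hy, hy'⟩
    exact absurd ⟨t, (ag.mono hy (hn t)).symm.trans hy'⟩ hx

/-- Restriction to the first `n` coordinates. -/
def rs (n : ℕ) (x : ℕ → T) : Fin n → T := fun i => x i

theorem rs_eq {n : ℕ} {x y : ℕ → T} : rs n x = rs n y ↔ ag n x y := by
  constructor
  · intro h i hi
    exact congrFun h ⟨i, hi⟩
  · intro h
    funext i
    exact h i i.2

theorem lev_of_not_tiny {k l : Cardinal.{u}} (hk : Cardinal.aleph0 < k) {E : Set (ℕ → T)}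
    (hE : ¬ Tiny k E) (hl : l < k) : ∃ n, l < Cardinal.mk (rs n '' E) := by
  by_contra hc
  push Not at hc
  apply hE
  have hsec : ∀ n, ∀ q : rs n '' E, ∃ x ∈ E, rs n x = q := fun n q => q.2
  choose s hs hs' using hsec
  refine ⟨⋃ n, range (s n), ?_, ?_⟩
  · have h0 : Cardinal.mk (⋃ n : ULift.{u} ℕ, range (s n.down)) ≤ max Cardinal.aleph0 l := by
      refine (Cardinal.mk_iUnion_le_sum_mk.trans (Cardinal.sum_le_sum (g := fun _ => l) _ ?_)).trans ?_
      · intro n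
        exact Cardinal.mk_range_le.trans (hc _)
      · rw [Cardinal.sum_const', Cardinal.mk_uLift, Cardinal.mk_nat, Cardinal.lift_aleph0]
        exact Cardinal.mul_le_max_of_aleph0_le_left le_rfl
    have e : (⋃ n : ULift.{u} ℕ, range (s n.down)) = ⋃ n, range (s n) := by
      ext x
      simp only [mem_iUnion, ULift.exists]
    rw [← e]
    exact h0.trans_lt (max_lt hk hl)
  · intro x hx
    rw [mem_closure_iff_nhds]
    intro O hO
    obtain ⟨n, hn⟩ := nhds_seq.1 hO
    refine ⟨s n ⟨rs n x, x, hx, rfl⟩, hn _ (rs_eq.1 (hs' n _)), ?_⟩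
    exact mem_iUnion.2 ⟨n, mem_range_self _⟩

theorem split_big {k : Cardinal.{u}} (hk : Cardinal.aleph0 < k) (hT : Cardinal.mk T = k)
    {P : Set (ℕ → T)} (hP : ∀ U, IsOpen U → (P ∩ U).Nonempty → ¬ Tiny k (P ∩ U))
    (U : Set (ℕ → T)) (hU : IsOpen U) (hne : (P ∩ U).Nonempty) :
    ∃ v : T → Set (ℕ → T), (∀ t, IsOpen (v t)) ∧ (∀ t, v t ⊆ U) ∧ (∀ t, (P ∩ v t).Nonempty) ∧
      DiscreteFamily v := by
  obtain ⟨y, hyP, hyU⟩ := hne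
  obtain ⟨N, hN⟩ := nhds_seq.1 (hU.mem_nhds hyU)
  set c : Set (ℕ → T) := {z | ag N z y} with hc
  have hnt : ¬ Tiny k (P ∩ c) := hP c (isClopen_cyl _ _).isOpen ⟨y, hyP, ag.refl _ _⟩
  -- reduction to points and levels
  suffices ∃ (n0 : ℕ) (a : T → ℕ → T) (n : T → ℕ), N ≤ n0 ∧ (∀ s, n0 ≤ n s) ∧
      (∀ s t, ag n0 (a s) (a t) → n s = n t) ∧ (∀ s t, ag (n s) (a s) (a t) → s = t) ∧
      ∀ s, a s ∈ P ∩ c by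
    obtain ⟨n0, a, n, h0, h1, h2, h3, h4⟩ := this
    refine ⟨_, fun t => (isClopen_cyl _ _).isOpen, fun t z hz => hN z ?_, fun t => ?_,
      discrete_cyl n0 a n h1 h2 h3⟩
    · exact (ag.mono hz (h0.trans (h1 t))).trans (h4 t).2
    · exact ⟨a t, (h4 t).1, ag.refl _ _⟩
  by_cases hbig : ∃ n, k ≤ Cardinal.mk (rs n '' (P ∩ c))
  · obtain ⟨n, hn⟩ := hbig
    rw [← hT] at hn
    obtain ⟨g⟩ := Cardinal.le_def _ _ |>.1 hn
    choose a ha ha' using fun t => (g t).2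
    refine ⟨max n N, a, fun _ => max n N, le_max_right _ _, fun _ => le_rfl, fun _ _ _ => rfl,
      fun s t h => ?_, ha⟩
    apply g.injective
    apply Subtype.ext
    rw [← ha', ← ha', rs_eq]
    exact h.mono (le_max_left _ _)
  · push Not at hbig
    obtain ⟨n0, hn0⟩ := lev_of_not_tiny hk hnt hk
    have : Cardinal.mk (ULift.{u} ℕ) ≤ Cardinal.mk (rs n0 '' (P ∩ c)) := by
      rw [Cardinal.mk_uLift, Cardinal.mk_nat, Cardinal.lift_aleph0]; exact hn0.le
    obtain ⟨g⟩ := Cardinal.le_def _ _ |>.1 this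
    choose p hp hp' using fun i : ℕ => (g ⟨i⟩).2
    have hpd : ∀ i j, ag n0 (p i) (p j) → i = j := by
      intro i j h
      have : g ⟨i⟩ = g ⟨j⟩ := Subtype.ext (by rw [← hp', ← hp', rs_eq]; exact h)
      simpa using g.injective this
    set n1 := max n0 N with hn1
    have hex : ∀ i : ℕ, ∃ n, Cardinal.mk (rs i '' (P ∩ c)) <
        Cardinal.mk (rs n '' (P ∩ {z | ag n1 z (p i)})) := fun i =>
      lev_of_not_tiny hk (hP _ (isClopen_cyl _ _).isOpen ⟨p i, (hp i).1, ag.refl _ _⟩) (hbig i)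
    choose n hn using hex
    have hsum : Cardinal.mk T ≤
        Cardinal.mk (Σ i : ULift.{u} ℕ, rs (n i.down) '' (P ∩ {z | ag n1 z (p i.down)})) := by
      rw [hT]
      by_contra hlt
      rw [not_le] at hlt
      obtain ⟨i, hi⟩ := lev_of_not_tiny hk hnt hlt
      refine absurd (hi.trans (hn i)) (not_lt.2 ?_)
      rw [Cardinal.mk_sigma]
      exact Cardinal.le_sum (fun i : ULift.{u} ℕ =>
        Cardinal.mk (rs (n i.down) '' (P ∩ {z | ag n1 z (p i.down)}))) ⟨i⟩
    obtain ⟨h⟩ := Cardinal.le_def _ _ |>.1 hsum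
    choose a ha ha' using fun t => (h t).2.2
    have hidx : ∀ s t, ag n1 (a s) (a t) → (h s).1 = (h t).1 := by
      intro s t hst
      have := (((ha s).2.symm.trans hst).trans (ha t).2).mono (le_max_left n0 N)
      exact ULift.ext _ _ (hpd _ _ this)
    refine ⟨n1, a, fun t => max n1 (n (h t).1.down), le_max_right _ _, fun _ => le_max_left _ _,
      fun s t hst => by dsimp only; rw [hidx s t hst], fun s t hst => ?_, fun s => ⟨(ha s).1, ?_⟩⟩
    · apply h.injective
      have e := hidx s t (hst.mono (le_max_left _ _))
      have e2 : rs (n (h s).1.down) (a s) = rs (n (h s).1.down) (a t) :=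
        rs_eq.2 (hst.mono (le_max_right _ _))
      have h1 := ha' s
      have h2 := ha' t
      generalize h s = A at *
      generalize h t = B at *
      obtain ⟨iA, A⟩ := A
      obtain ⟨iB, B⟩ := B
      dsimp only at e
      subst e
      congr 1
      exact Subtype.ext (h1.symm.trans (e2.trans h2))
    · exact ((ha s).2.mono (le_max_right _ _)).trans (hp _).2

theorem split_two {k : Cardinal.{u}} (hk : Cardinal.aleph0 ≤ k) (b : T ≃ Bool)
    {P : Set (ℕ → T)} (hP : ∀ U, IsOpen U → (P ∩ U).Nonempty → ¬ Tiny k (P ∩ U))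
    (U : Set (ℕ → T)) (hU : IsOpen U) (hne : (P ∩ U).Nonempty) :
    ∃ v : T → Set (ℕ → T), (∀ t, IsOpen (v t)) ∧ (∀ t, v t ⊆ U) ∧ (∀ t, (P ∩ v t).Nonempty) ∧
      DiscreteFamily v := by
  have hnt := hP U hU hne
  have : ∃ p ∈ P ∩ U, ∃ q ∈ P ∩ U, p ≠ q := by
    by_contra hc
    push Not at hc
    refine hnt ⟨P ∩ U, ?_, subset_closure⟩
    exact (Cardinal.mk_le_one_iff_set_subsingleton.2 fun x hx y hy => hc x hx y hy).trans_lt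
      (Cardinal.one_lt_aleph0.trans_le hk)
  obtain ⟨p, hp, q, hq, hpq⟩ := this
  obtain ⟨i, hi⟩ := Function.ne_iff.1 hpq
  obtain ⟨N, hN⟩ := nhds_seq.1 (hU.mem_nhds hp.2)
  obtain ⟨M, hM⟩ := nhds_seq.1 (hU.mem_nhds hq.2)
  set n := max (i + 1) (max N M) with hn
  have hin : i < n := lt_of_lt_of_le i.lt_succ_self (le_max_left _ _)
  have hNn : N ≤ n := (le_max_left _ _).trans (le_max_right _ _)
  have hMn : M ≤ n := (le_max_right _ _).trans (le_max_right _ _)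
  refine ⟨_, fun t => (isClopen_cyl _ _).isOpen, fun t => ?_, fun t => ?_,
    discrete_cyl n (fun t => if b t then p else q) (fun _ => n) (fun _ => le_rfl)
      (fun _ _ _ => rfl) ?_⟩
  · intro z hz
    by_cases hb : b t = true
    · simp only [hb, if_true, mem_ofPred_eq] at hz
      exact hN z (ag.mono hz hNn)
    · simp only [hb, mem_ofPred_eq] at hz
      exact hM z (ag.mono hz hMn)
  · refine ⟨_, ?_, ag.refl _ _⟩
    split_ifs
    exacts [hp.1, hq.1]
  · intro s t h
    apply b.injective
    have h' := h i hin
    by_cases hs : b s = true <;> by_cases ht : b t = true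
    · rw [hs, ht]
    · simp only [hs, ht, if_true] at h'; exact absurd h' hi
    · simp only [hs, ht, if_true] at h'; exact absurd h'.symm hi
    · rw [Bool.not_eq_true] at hs ht; rw [hs, ht]

end Split



section Ideal

variable {T : Type u} [TopologicalSpace T] [DiscreteTopology T]

/-- Points having a cylinder with property `N`. -/
def GoodN (N : Set (ℕ → T) → Prop) : Set (ℕ → T) := {x | ∃ n, N {y | ag n y x}}

open Classical in
/-- The largest cylinder around `x` with property `N`. -/
noncomputable def bigC (N : Set (ℕ → T) → Prop) (x : ℕ → T) : Set (ℕ → T) :=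
  if h : ∃ n, N {y | ag n y x} then {y | ag (Nat.find h) y x} else univ

theorem bigC_spec {N : Set (ℕ → T) → Prop} {x : ℕ → T} (hx : x ∈ GoodN N) :
    N (bigC N x) ∧ x ∈ bigC N x ∧ IsOpen (bigC N x) ∧
      ∀ y ∈ bigC N x, y ∈ GoodN N ∧ bigC N y = bigC N x := by
  classical
  have hx' : ∃ n, N {y | ag n y x} := hx
  have e : bigC N x = {y | ag (Nat.find hx') y x} := dif_pos hx'
  refine ⟨?_, ?_, ?_, ?_⟩
  · rw [e]; exact Nat.find_spec hx'
  · rw [e]; exact ag.refl _ _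
  · rw [e]; exact (isClopen_cyl _ _).isOpen
  · intro y hy
    rw [e] at hy
    have hcyl : ∀ n ≤ Nat.find hx', {z | ag n z y} = {z | ag n z x} := by
      intro n hn
      ext z
      exact ⟨fun h => ag.trans h (ag.mono hy hn), fun h => ag.trans h (ag.mono hy hn).symm⟩
    have hy' : ∃ n, N {z | ag n z y} := ⟨Nat.find hx', by
      rw [hcyl _ le_rfl]; exact Nat.find_spec hx'⟩
    refine ⟨hy', ?_⟩
    have ef : Nat.find hy' = Nat.find hx' := by
      have a : Nat.find hy' ≤ Nat.find hx' := Nat.find_min' hy' (by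
        rw [hcyl _ le_rfl]; exact Nat.find_spec hx')
      refine le_antisymm a (Nat.find_min' hx' ?_)
      rw [← hcyl _ a]; exact Nat.find_spec hy'
    rw [e, show bigC N y = {z | ag (Nat.find hy') z y} from dif_pos hy', ef, hcyl _ le_rfl]

/-- Gluing sets along the maximal cylinders. -/
def glue (N : Set (ℕ → T) → Prop) (H : Set (ℕ → T) → Set (ℕ → T)) : Set (ℕ → T) :=
  {x | x ∈ GoodN N ∧ x ∈ H (bigC N x)}

theorem isOpen_glue {N : Set (ℕ → T) → Prop} {H : Set (ℕ → T) → Set (ℕ → T)}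
    (hH : ∀ c, N c → IsOpen (H c)) : IsOpen (glue N H) := by
  rw [isOpen_iff_mem_nhds]
  rintro x ⟨hx, hx'⟩
  obtain ⟨h1, h2, h3, h4⟩ := bigC_spec hx
  filter_upwards [h3.mem_nhds h2, (hH _ h1).mem_nhds hx'] with y hy hy'
  exact ⟨(h4 y hy).1, by rw [(h4 y hy).2]; exact hy'⟩

theorem isGδ_glue {N : Set (ℕ → T) → Prop} {H : Set (ℕ → T) → Set (ℕ → T)}
    (hH : ∀ c, N c → IsGδ (H c)) : IsGδ (glue N H) := by
  have : ∀ c, ∃ O : ℕ → Set (ℕ → T), N c → (∀ j, IsOpen (O j)) ∧ H c = ⋂ j, O j := by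
    intro c
    by_cases h : N c
    · obtain ⟨f, h1, h2⟩ := isGδ_iff_eq_iInter_nat.1 (hH c h)
      exact ⟨f, fun _ => ⟨h1, h2⟩⟩
    · exact ⟨fun _ => univ, fun h' => absurd h' h⟩
  choose O hO using this
  have : glue N H = ⋂ j, glue N fun c => O c j := by
    ext x
    simp only [glue, mem_ofPred_eq, mem_iInter]
    constructor
    · rintro ⟨h1, h2⟩ j
      refine ⟨h1, ?_⟩
      rw [(hO _ (bigC_spec h1).1).2] at h2
      exact mem_iInter.1 h2 j
    · intro h
      refine ⟨(h 0).1, ?_⟩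
      rw [(hO _ (bigC_spec (h 0).1).1).2]
      exact mem_iInter.2 fun j => (h j).2
  rw [this]
  exact IsGδ.iInter_of_isOpen fun j => isOpen_glue fun c hc => (hO c hc).1 j

/-- The `σ`-ideal of sets which are σ-locally small. -/
def SmallS (k : Cardinal.{u}) (L : Set (ℕ → T)) : Prop :=
  ∃ S : ℕ → Set (ℕ → T), L ⊆ ⋃ n, S n ∧ ∀ n, ∀ x ∈ S n, ∃ V ∈ 𝓝 x, Tiny k (S n ∩ V)

/-- The ideal of negligible subsets. -/
def IdI (k : Cardinal.{u}) (Y A : Set (ℕ → T)) : Prop :=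
  ∃ G : ℕ → Set (ℕ → T), (∀ n, IsGδ (G n) ∧ G n ⊆ Y) ∧ SmallS k (A \ ⋃ n, G n)

theorem SmallS.mono {k : Cardinal.{u}} {L L' : Set (ℕ → T)} (h : SmallS k L) (hL : L' ⊆ L) :
    SmallS k L' := by
  obtain ⟨S, h1, h2⟩ := h
  exact ⟨S, hL.trans h1, h2⟩

theorem SmallS.iUnion {k : Cardinal.{u}} {L : ℕ → Set (ℕ → T)} (h : ∀ i, SmallS k (L i)) :
    SmallS k (⋃ i, L i) := by
  choose S h1 h2 using h
  refine ⟨fun n => S n.unpair.1 n.unpair.2, ?_, fun n => h2 _ _⟩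
  refine iUnion_subset fun i x hx => ?_
  obtain ⟨j, hj⟩ := mem_iUnion.1 (h1 i hx)
  exact mem_iUnion.2 ⟨Nat.pair i j, by simpa using hj⟩

variable {k : Cardinal.{u}} {Y : Set (ℕ → T)}

theorem IdI.mono {A B : Set (ℕ → T)} (h : IdI k Y A) (hB : B ⊆ A) : IdI k Y B := by
  obtain ⟨G, h1, h2⟩ := h
  exact ⟨G, h1, h2.mono (sdiff_subset_sdiff_left hB)⟩

theorem IdI.iUnion {A : ℕ → Set (ℕ → T)} (h : ∀ i, IdI k Y (A i)) : IdI k Y (⋃ i, A i) := by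
  choose G h1 h2 using h
  refine ⟨fun n => G n.unpair.1 n.unpair.2, fun n => h1 _ _, (SmallS.iUnion h2).mono ?_⟩
  rintro x ⟨hx, hx'⟩
  obtain ⟨i, hi⟩ := mem_iUnion.1 hx
  refine mem_iUnion.2 ⟨i, hi, fun h => hx' ?_⟩
  obtain ⟨j, hj⟩ := mem_iUnion.1 h
  exact mem_iUnion.2 ⟨Nat.pair i j, by simpa using hj⟩

theorem IdI.union {A B : Set (ℕ → T)} (hA : IdI k Y A) (hB : IdI k Y B) : IdI k Y (A ∪ B) := by
  refine (IdI.iUnion (A := fun n => if n = 0 then A else B) fun i => ?_).mono ?_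
  · by_cases h : i = 0
    · simpa [h] using hA
    · simpa [h] using hB
  · rintro x (hx | hx)
    · exact mem_iUnion.2 ⟨0, by simpa using hx⟩
    · exact mem_iUnion.2 ⟨1, by simpa using hx⟩

theorem IdI.gdelta {G : Set (ℕ → T)} (hG : IsGδ G) (h : G ⊆ Y) : IdI k Y G :=
  ⟨fun _ => G, fun _ => ⟨hG, h⟩, ⟨fun _ => ∅, by simp [iUnion_const], fun n x hx => absurd hx (by simp)⟩⟩

theorem IdI.tiny {A : Set (ℕ → T)} (h : Tiny k A) : IdI k Y A := by
  refine ⟨fun _ => ∅, fun _ => ⟨IsGδ.empty, empty_subset _⟩, fun _ => A, ?_, fun n x hx => ?_⟩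
  · intro x hx; exact mem_iUnion.2 ⟨0, hx.1⟩
  · exact ⟨univ, univ_mem, h.mono inter_subset_left⟩

theorem IdI.loc {A : Set (ℕ → T)} (h : ∀ x ∈ A, ∃ V, IsOpen V ∧ x ∈ V ∧ IdI k Y (A ∩ V)) :
    IdI k Y A := by
  set N : Set (ℕ → T) → Prop := fun U => IdI k Y (A ∩ U) with hN
  have hgood : ∀ x ∈ A, x ∈ GoodN N := by
    intro x hx
    obtain ⟨V, hV, hxV, hI⟩ := h x hx
    obtain ⟨n, hn⟩ := nhds_seq.1 (hV.mem_nhds hxV)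
    exact ⟨n, hI.mono (inter_subset_inter_right _ hn)⟩
  have : ∀ c, ∃ G S : ℕ → Set (ℕ → T), N c → (∀ n, IsGδ (G n) ∧ G n ⊆ Y) ∧
      ((A ∩ c) \ ⋃ n, G n) ⊆ ⋃ n, S n ∧ ∀ n, ∀ x ∈ S n, ∃ V ∈ 𝓝 x, Tiny k (S n ∩ V) := by
    intro c
    by_cases hc : N c
    · obtain ⟨G, h1, S, h2, h3⟩ := hc
      exact ⟨G, S, fun _ => ⟨h1, h2, h3⟩⟩
    · exact ⟨fun _ => ∅, fun _ => ∅, fun h => absurd h hc⟩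
  choose G S hGS using this
  refine ⟨fun n => glue N fun c => G c n, fun n => ⟨isGδ_glue fun c hc => ((hGS c hc).1 n).1, ?_⟩,
    fun n => glue N fun c => S c n, ?_, ?_⟩
  · rintro x ⟨hx, hx'⟩
    exact ((hGS _ (bigC_spec hx).1).1 n).2 hx'
  · rintro x ⟨hx, hx'⟩
    have hg := hgood x hx
    have hb := bigC_spec hg
    have : x ∈ ⋃ n, S (bigC N x) n := (hGS _ hb.1).2.1 ⟨⟨hx, hb.2.1⟩, fun hc => hx' (by
      obtain ⟨n, hn⟩ := mem_iUnion.1 hc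
      exact mem_iUnion.2 ⟨n, hg, hn⟩)⟩
    obtain ⟨n, hn⟩ := mem_iUnion.1 this
    exact mem_iUnion.2 ⟨n, hg, hn⟩
  · rintro n x ⟨hx, hx'⟩
    have hb := bigC_spec hx
    obtain ⟨V, hV, ht⟩ := (hGS _ hb.1).2.2 n x hx'
    refine ⟨V ∩ bigC N x, Filter.inter_mem hV (hb.2.2.1.mem_nhds hb.2.1), ht.mono ?_⟩
    rintro y ⟨hy, hyV, hyc⟩
    have := hy.2
    rw [(hb.2.2.2 y hyc).2] at this
    exact ⟨this, hyV⟩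

/-- The family of good pieces. -/
def PfX (k : Cardinal.{u}) (Y : Set (ℕ → T)) (F : ℕ → ℕ → Set (ℕ → T)) (m : ℕ)
    (P : Set (ℕ → T)) : Prop :=
  (∃ C, IsClosed C ∧ P = Y ∩ C) ∧ P.Nonempty ∧
    ∀ U, IsOpen U → (P ∩ U).Nonempty → ¬ IdI k Y (P ∩ U) ∧ ∀ j, ¬ P ∩ U ⊆ F m j

/-- Removability modulo the ideal. -/
def NegP (k : Cardinal.{u}) (Y : Set (ℕ → T)) (Fm : ℕ → Set (ℕ → T)) (R U : Set (ℕ → T)) : Prop :=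
  ∃ G, IsGδ G ∧ G ⊆ ⋃ j, Fm j ∧ IdI k Y ((R ∩ U) \ G)

theorem NegP.mono {Fm : ℕ → Set (ℕ → T)} {R U U' : Set (ℕ → T)} (h : NegP k Y Fm R U)
    (hU : U' ⊆ U) : NegP k Y Fm R U' := by
  obtain ⟨G, h1, h2, h3⟩ := h
  exact ⟨G, h1, h2, h3.mono (sdiff_subset_sdiff_left (inter_subset_inter_right _ hU))⟩

theorem NegP.good (Fm : ℕ → Set (ℕ → T)) (R : Set (ℕ → T)) :
    NegP k Y Fm R (GoodN (NegP k Y Fm R)) := by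
  set N := NegP k Y Fm R with hN
  have : ∀ c, ∃ G, N c → IsGδ G ∧ G ⊆ ⋃ j, Fm j ∧ IdI k Y ((R ∩ c) \ G) := by
    intro c
    by_cases hc : N c
    · obtain ⟨G, hG⟩ := hc
      exact ⟨G, fun _ => hG⟩
    · exact ⟨∅, fun h => absurd h hc⟩
  choose G hG using this
  refine ⟨glue N G, isGδ_glue fun c hc => (hG c hc).1, ?_, IdI.loc ?_⟩
  · rintro x ⟨hx, hx'⟩
    exact (hG _ (bigC_spec hx).1).2.1 hx'
  · rintro x ⟨⟨hx, hx'⟩, -⟩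
    have hb := bigC_spec hx'
    refine ⟨bigC N x, hb.2.2.1, hb.2.1, (hG _ hb.1).2.2.mono ?_⟩
    rintro y ⟨⟨⟨h1, h2⟩, h3⟩, h4⟩
    refine ⟨⟨h1, h4⟩, fun h => h3 ⟨h2, ?_⟩⟩
    rw [(hb.2.2.2 y h4).2]; exact h

theorem pf_of_not_neg {F : ℕ → ℕ → Set (ℕ → T)} (hF : ∀ m j, IsClosed (F m j)) (m : ℕ)
    {C : Set (ℕ → T)} (hC : IsClosed C) (h : ¬ NegP k Y (F m) (Y ∩ C) univ) :
    ∃ P, P ⊆ Y ∩ C ∧ PfX k Y F m P := by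
  set R := Y ∩ C with hR
  set N := NegP k Y (F m) R with hN
  obtain ⟨G, g1, g2, g3⟩ := NegP.good (k := k) (Y := Y) (F m) R
  have hopen : IsOpen (GoodN N) := by
    have : GoodN N = glue N fun _ => univ := by ext x; simp [glue]
    rw [this]; exact isOpen_glue fun _ _ => isOpen_univ
  refine ⟨R \ GoodN N, sdiff_subset, ⟨C ∩ (GoodN N)ᶜ, hC.inter hopen.isClosed_compl, ?_⟩, ?_, ?_⟩
  · ext x; simp only [hR, Set.mem_sdiff, mem_inter_iff, mem_compl_iff]; tauto
  · by_contra hc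
    rw [not_nonempty_iff_eq_empty, sdiff_eq_empty] at hc
    refine h ⟨G, g1, g2, g3.mono ?_⟩
    rintro x ⟨⟨h1, -⟩, h2⟩
    exact ⟨⟨h1, hc h1⟩, h2⟩
  · rintro U hU ⟨y, ⟨hyR, hyG⟩, hyU⟩
    have contra : ¬ N U := by
      intro hneg
      obtain ⟨n, hn⟩ := nhds_seq.1 (hU.mem_nhds hyU)
      exact hyG ⟨n, hneg.mono hn⟩
    refine ⟨fun hI => contra ⟨G, g1, g2, (hI.union g3).mono ?_⟩, fun j hj => contra
      ⟨G ∪ closure ((R \ GoodN N) ∩ U), g1.union isClosed_closure.isGδ, union_subset g2 ?_,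
        g3.mono ?_⟩⟩
    · rintro x ⟨⟨h1, h2⟩, h3⟩
      by_cases hx : x ∈ GoodN N
      · exact Or.inr ⟨⟨h1, hx⟩, h3⟩
      · exact Or.inl ⟨⟨h1, hx⟩, h2⟩
    · exact (closure_minimal hj (hF m j)).trans (subset_iUnion _ j)
    · rintro x ⟨⟨h1, h2⟩, h3⟩
      refine ⟨⟨h1, ?_⟩, fun h => h3 (Or.inl h)⟩
      by_contra hx
      exact h3 (Or.inr (subset_closure ⟨⟨h1, hx⟩, h2⟩))

theorem lemmaA {F : ℕ → ℕ → Set (ℕ → T)} (hF : ∀ m j, IsClosed (F m j))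
    (hanti : ∀ m j, F (m + 1) j ⊆ F m j) (hY : Y = ⋂ m, ⋃ j, F m j)
    {C : Set (ℕ → T)} (hC : IsClosed C) (h : ¬ IdI k Y (Y ∩ C)) (m0 : ℕ) :
    ∃ m P, m0 < m ∧ P ⊆ Y ∩ C ∧ PfX k Y F m P := by
  by_cases hm : ∃ m, ¬ NegP k Y (F m) (Y ∩ C) univ
  · obtain ⟨m, hm⟩ := hm
    obtain ⟨P, h1, h2, h3, h4⟩ := pf_of_not_neg hF m hC hm
    refine ⟨m + (m0 + 1), P, by omega, h1, h2, h3, fun U hU hne => ⟨(h4 U hU hne).1, fun j hj => ?_⟩⟩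
    refine (h4 U hU hne).2 j (hj.trans ?_)
    have : ∀ d, F (m + d) j ⊆ F m j := by
      intro d
      induction d with
      | zero => exact subset_rfl
      | succ d ih => exact (hanti _ _).trans ih
    exact this _
  · push Not at hm
    choose G g1 g2 g3 using hm
    refine absurd ?_ h
    have hGd : IdI k Y (⋂ m, G m) := IdI.gdelta (IsGδ.iInter g1) (by
      rw [hY]; exact iInter_mono g2)
    refine ((IdI.iUnion g3).union hGd).mono fun x hx => ?_
    by_cases hxG : x ∈ ⋂ m, G m
    · exact Or.inr hxG
    · rw [mem_iInter] at hxG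
      push Not at hxG
      obtain ⟨m, hm⟩ := hxG
      exact Or.inl (mem_iUnion.2 ⟨m, ⟨hx, mem_univ _⟩, hm⟩)

theorem schemeX {F : ℕ → ℕ → Set (ℕ → T)} (hF : ∀ m j, IsClosed (F m j))
    (hanti : ∀ m j, F (m + 1) j ⊆ F m j) (hmono : ∀ m, Monotone (F m))
    (hY : Y = ⋂ m, ⋃ j, F m j)
    (hsplit : ∀ P : Set (ℕ → T), (∀ U, IsOpen U → (P ∩ U).Nonempty → ¬ Tiny k (P ∩ U)) →
      ∀ U, IsOpen U → (P ∩ U).Nonempty → ∃ v : T → Set (ℕ → T), (∀ t, IsOpen (v t)) ∧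
        (∀ t, v t ⊆ U) ∧ (∀ t, (P ∩ v t).Nonempty) ∧ DiscreteFamily v) :
    SchemeHyp F (PfX k Y F) where
  closed := hF
  mono := hmono
  anti := fun m x ⟨j, hj⟩ => ⟨j, hanti m j hj⟩
  nonempty := fun m P h => h.2.1
  codense := by
    intro m P U j hP hU hne
    have := (hP.2.2 U hU hne).2 j
    rw [not_subset] at this
    obtain ⟨y, h1, h2⟩ := this
    exact ⟨y, h1.1, h1.2, h2⟩
  split := fun m P U hP hU hne =>
    hsplit P (fun U hU hne ht => (hP.2.2 U hU hne).1 (IdI.tiny ht)) U hU hne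
  next := by
    rintro m P U ⟨⟨C, hC, rfl⟩, -, hP⟩ hU ⟨y, hy, hyU⟩
    obtain ⟨n, hn⟩ := nhds_seq.1 (hU.mem_nhds hyU)
    set c : Set (ℕ → T) := {z | ag n z y} with hc
    have hcc : IsClopen c := isClopen_cyl _ _
    have hnI := (hP c hcc.isOpen ⟨y, hy, ag.refl _ _⟩).1
    have : ∃ j, ¬ IdI k Y (Y ∩ (C ∩ c ∩ F m j)) := by
      by_contra hcon
      push Not at hcon
      refine hnI ((IdI.iUnion hcon).mono ?_)
      rintro x ⟨⟨h1, h2⟩, h3⟩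
      have : x ∈ ⋃ j, F m j := by
        rw [hY] at h1; exact mem_iInter.1 h1 m
      obtain ⟨j, hj⟩ := mem_iUnion.1 this
      exact mem_iUnion.2 ⟨j, h1, ⟨h2, h3⟩, hj⟩
    obtain ⟨j, hj⟩ := this
    obtain ⟨m', P', h1, h2, h3⟩ := lemmaA hF hanti hY ((hC.inter hcc.isClosed).inter (hF m j)) hj m
    exact ⟨j, m', P', h1, h3, fun x hx => ⟨(h2 hx).1, (h2 hx).2.1.1⟩,
      fun x hx => hn x (h2 hx).2.1.2, fun x hx => (h2 hx).2.2⟩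

end Ideal



section Start

variable {T : Type u} [TopologicalSpace T] [DiscreteTopology T]

theorem weightLT_of_tiny {k : Cardinal.{u}} (hk : Cardinal.aleph0 ≤ k) {E : Set (ℕ → T)}
    (hE : Tiny k E) {Z : Type u} [TopologicalSpace Z] (j : Z → ℕ → T) (hj : IsEmbedding j)
    (hjE : ∀ z, j z ∈ E) : WeightLT Z k := by
  obtain ⟨D, hD, hED⟩ := hE
  rcases hk.eq_or_lt with rfl | hk
  · have hfin : D.Finite := Cardinal.lt_aleph0_iff_set_finite.1 hD
    rw [hfin.isClosed.closure_eq] at hED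
    have : Finite D := hfin
    have hZ : Finite Z := Finite.of_injective (fun z => (⟨j z, hED (hjE z)⟩ : D)) fun a b h =>
      hj.injective (Subtype.ext_iff.1 h)
    have : T2Space Z := hj.t2Space
    refine ⟨{s | ∃ x : Z, s = {x}}, isTopologicalBasis_singletons Z, ?_⟩
    have : {s : Set Z | ∃ x : Z, s = {x}} = range fun x : Z => ({x} : Set Z) := by
      ext s; simp [eq_comm]
    rw [this]
    exact Cardinal.lt_aleph0_iff_set_finite.2 (finite_range _)
  · refine ⟨range fun p : D × ULift.{u} ℕ => j ⁻¹' {y | ag p.2.down y p.1.1}, ?_, ?_⟩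
    · refine TopologicalSpace.isTopologicalBasis_of_isOpen_of_nhds ?_ ?_
      · rintro _ ⟨p, rfl⟩
        exact (isClopen_cyl _ _).isOpen.preimage hj.continuous
      · intro z O hz hO
        obtain ⟨n, hn⟩ := (nhds_ind hj.isInducing).1 (hO.mem_nhds hz)
        have := hED (hjE z)
        rw [mem_closure_iff_nhds] at this
        obtain ⟨d, hd, hdD⟩ := this _ ((isClopen_cyl n (j z)).isOpen.mem_nhds (ag.refl _ _))
        refine ⟨_, ⟨⟨⟨d, hdD⟩, ⟨n⟩⟩, rfl⟩, ag.symm hd, fun y hy => hn y (ag.trans hy hd)⟩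
    · refine Cardinal.mk_range_le.trans_lt ?_
      rw [Cardinal.mk_prod, Cardinal.lift_id, Cardinal.lift_id, Cardinal.mk_uLift, Cardinal.mk_nat,
        Cardinal.lift_aleph0]
      exact Cardinal.mul_lt_of_lt hk.le hD hk

theorem IsFsigmaSet.inter {Y : Type*} [TopologicalSpace Y] {s t : Set Y} (hs : IsFsigmaSet s)
    (ht : IsFsigmaSet t) : IsFsigmaSet (s ∩ t) := by
  obtain ⟨A, hA, rfl⟩ := hs
  obtain ⟨B, hB, rfl⟩ := ht
  refine ⟨fun n => A n.unpair.1 ∩ B n.unpair.2, fun n => (hA _).inter (hB _), ?_⟩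
  ext x
  simp only [mem_inter_iff, mem_iUnion]
  constructor
  · rintro ⟨⟨i, hi⟩, ⟨j, hj⟩⟩
    exact ⟨Nat.pair i j, by simpa using ⟨hi, hj⟩⟩
  · rintro ⟨n, h1, h2⟩
    exact ⟨⟨_, h1⟩, ⟨_, h2⟩⟩

theorem IsClosed.isFsigmaSet {Y : Type*} [TopologicalSpace Y] {s : Set Y} (hs : IsClosed s) :
    IsFsigmaSet s := ⟨fun _ => s, fun _ => hs, by rw [iUnion_const]⟩

theorem isFsigmaSet_compl_gdelta {Y : Type*} [TopologicalSpace Y] {s : Set Y} (hs : IsGδ s) :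
    IsFsigmaSet sᶜ := by
  obtain ⟨f, hf, rfl⟩ := isGδ_iff_eq_iInter_nat.1 hs
  exact ⟨fun j => (f j)ᶜ, fun j => (hf j).isClosed_compl, by rw [compl_iInter]⟩

theorem IsOpen.isFsigmaSet {Y : Type*} [TopologicalSpace Y] [PerfectlyNormalSpace Y] {s : Set Y}
    (hs : IsOpen s) : IsFsigmaSet s := by
  have := isFsigmaSet_compl_gdelta hs.isClosed_compl.isGδ
  rwa [compl_compl] at this

theorem absFsigmaDelta_of {F : Set (ℕ → T)} (hF : IsFsigmaDelta F) : AbsFsigmaDelta ↥F := by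
  refine ⟨inferInstance, ?_⟩
  intro Y _ _ f hf
  obtain ⟨F', hF', hFe⟩ := hF
  choose C hC he using hF'
  have hFm : ∀ z, z ∈ F ↔ ∀ n, z ∈ F' n := by
    intro z
    rw [hFe, mem_iInter]
  let A : ℕ → T → Set Y := fun n t => ⋃₀ {V | IsOpen V ∧ ∀ x : F, f x ∈ V → x.1 n = t}
  have hAo : ∀ n t, IsOpen (A n t) := fun n t => isOpen_sUnion fun V hV => hV.1
  have hAx : ∀ n t (x : F), f x ∈ A n t → x.1 n = t := by
    rintro n t x ⟨V, hV, hx⟩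
    exact hV.2 x hx
  let B : ℕ → ℕ → Set Y := fun m j => ⋃₀ {V | IsOpen V ∧ ∃ n p, (∀ x : F, f x ∈ V → ag n x.1 p) ∧
    ∀ z ∈ C m j, ¬ ag n z p}
  have hBo : ∀ m j, IsOpen (B m j) := fun m j => isOpen_sUnion fun V hV => hV.1
  have hcyl : ∀ (x : F) n, ∃ V, IsOpen V ∧ f x ∈ V ∧ ∀ x' : F, f x' ∈ V → ag n x'.1 x.1 := by
    intro x n
    have h1 : IsOpen {x' : F | ag n x'.1 x.1} :=
      (isClopen_cyl n x.1).isOpen.preimage continuous_subtype_val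
    obtain ⟨V, hV, h2⟩ := hf.isInducing.isOpen_iff.1 h1
    refine ⟨V, hV, ?_, ?_⟩
    · have : x ∈ f ⁻¹' V := by rw [h2]; exact ag.refl _ _
      exact this
    · intro x' hx'
      have : x' ∈ f ⁻¹' V := hx'
      rw [h2] at this; exact this
  refine ⟨fun n => closure (range f) ∩ (⋃ t, A n t) ∩ ⋃ j, (B n j)ᶜ, fun n => ?_, ?_⟩
  · exact (isClosed_closure.isFsigmaSet.inter (isOpen_iUnion (hAo n)).isFsigmaSet).inter
      ⟨fun j => (B n j)ᶜ, fun j => (hBo n j).isClosed_compl, rfl⟩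
  apply Subset.antisymm
  · rintro _ ⟨x, rfl⟩
    refine mem_iInter.2 fun n => ⟨⟨subset_closure ⟨x, rfl⟩, ?_⟩, ?_⟩
    · obtain ⟨V, h1, h2, h3⟩ := hcyl x (n + 1)
      exact mem_iUnion.2 ⟨x.1 n, V, ⟨h1, fun x' hx' => h3 x' hx' n n.lt_succ_self⟩, h2⟩
    · have hx : x.1 ∈ F' n := (hFm _).1 x.2 n
      rw [he n] at hx
      obtain ⟨j, hj⟩ := mem_iUnion.1 hx
      refine mem_iUnion.2 ⟨j, ?_⟩
      rintro ⟨V, ⟨-, N, p, h1, h2⟩, hV⟩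
      exact h2 _ hj (h1 x hV)
  · intro y hy
    rw [mem_iInter] at hy
    have hcl : y ∈ closure (range f) := (hy 0).1.1
    choose g hg using fun n => mem_iUnion.1 (hy n).1.2
    let O : ℕ → Set Y := fun n => ⋂ i ∈ Set.Iio n, A i (g i)
    have hOo : ∀ n, IsOpen (O n) := fun n => (Set.finite_Iio n).isOpen_biInter fun i _ => hAo _ _
    have hyO : ∀ n, y ∈ O n := fun n => mem_iInter₂.2 fun i _ => hg i
    have hOx : ∀ n (x : F), f x ∈ O n → ag n x.1 g := fun n x hx i hi =>
      hAx _ _ _ (mem_iInter₂.1 hx i hi)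
    have hgF : g ∈ F := by
      refine (hFm _).2 fun m => ?_
      obtain ⟨j, hj⟩ := mem_iUnion.1 (hy m).2
      rw [he m]
      refine mem_iUnion.2 ⟨j, ?_⟩
      by_contra hc
      obtain ⟨n, hn⟩ := nhds_seq.1 ((hC m j).isOpen_compl.mem_nhds hc)
      exact hj ⟨O n, ⟨hOo n, n, g, hOx n, fun z hz h => hn z h hz⟩, hyO n⟩
    refine ⟨⟨g, hgF⟩, ?_⟩
    by_contra hne
    obtain ⟨V2, V1, h2, h1, m2, m1, hd⟩ := t2_separation hne
    have h3 : f ⁻¹' V2 ∈ 𝓝 (⟨g, hgF⟩ : F) := (h2.preimage hf.continuous).mem_nhds m2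
    obtain ⟨n, hn⟩ := (nhds_ind (IsInducing.subtypeVal)).1 h3
    obtain ⟨_, ⟨hz1, hz2⟩, x, rfl⟩ := mem_closure_iff.1 hcl (V1 ∩ O n) (h1.inter (hOo n)) ⟨m1, hyO n⟩
    exact disjoint_left.1 hd (hn x (hOx n x hz2)) hz1

theorem homeo_of_range {A B C : Type*} [TopologicalSpace A] [TopologicalSpace B]
    [TopologicalSpace C] {f : A → C} {g : B → C} (hf : IsEmbedding f) (hg : IsEmbedding g)
    (h : range f = range g) : Nonempty (A ≃ₜ B) :=
  ⟨hf.toHomeomorph.trans ((Homeomorph.setCongr h).trans hg.toHomeomorph.symm)⟩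

theorem not_idI {k : Cardinal.{u}} (hk : Cardinal.aleph0 ≤ k) {X : Type u} [TopologicalSpace X]
    (e : X → ℕ → T) (he : IsEmbedding e) (hnw : NowhereFsdMinusSLW X k) (U : Set (ℕ → T))
    (hU : IsOpen U) (hne : (U ∩ range e).Nonempty) : ¬ IdI k (range e)ᶜ ((range e)ᶜ ∩ U) := by
  rintro ⟨G, hG, S, hS, hS'⟩
  obtain ⟨_, hxU, x0, rfl⟩ := hne
  refine hnw (e ⁻¹' U) (hU.preimage he.continuous) ⟨x0, hxU⟩ ?_
  set F : Set (ℕ → T) := ⋂ n, (U ∩ (G n)ᶜ) with hF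
  have hFd : IsFsigmaDelta F :=
    ⟨_, fun n => hU.isFsigmaSet.inter (isFsigmaSet_compl_gdelta (hG n).1), rfl⟩
  set L : Set F := {y | y.1 ∉ range e} with hL
  refine ⟨TopCat.of F, L, absFsigmaDelta_of hFd, ?_, ?_⟩
  · refine ⟨fun n => {l : L | l.1.1 ∈ S n}, ?_, ?_⟩
    · refine eq_univ_of_forall fun l => ?_
      have hl := mem_iInter.1 l.1.2
      have : l.1.1 ∈ ⋃ n, S n := hS ⟨⟨l.2, (hl 0).1⟩, fun h => by
        obtain ⟨n, hn⟩ := mem_iUnion.1 h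
        exact (hl n).2 hn⟩
      obtain ⟨n, hn⟩ := mem_iUnion.1 this
      exact mem_iUnion.2 ⟨n, hn⟩
    · intro n s
      obtain ⟨V, hV, ht⟩ := hS' n s.1.1.1 s.2
      have hc : Continuous fun s : {l : L | l.1.1 ∈ S n} => s.1.1.1 := by fun_prop
      refine ⟨(fun s : {l : L | l.1.1 ∈ S n} => s.1.1.1) ⁻¹' V, hc.continuousAt.preimage_mem_nhds hV, ?_⟩
      refine weightLT_of_tiny hk ht (fun z => z.1.1.1.1) ?_ ?_
      · exact IsEmbedding.subtypeVal.comp (IsEmbedding.subtypeVal.comp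
          (IsEmbedding.subtypeVal.comp IsEmbedding.subtypeVal))
      · intro z
        exact ⟨z.1.2, z.2⟩
  · have h1 : IsEmbedding fun x : ↥(e ⁻¹' U) => e x.1 := he.comp IsEmbedding.subtypeVal
    have h2 : IsEmbedding fun x : ↥(Lᶜ) => x.1.1 :=
      IsEmbedding.subtypeVal.comp IsEmbedding.subtypeVal
    refine homeo_of_range h1 h2 ?_
    ext y
    constructor
    · rintro ⟨x, rfl⟩
      refine ⟨⟨⟨e x.1, mem_iInter.2 fun n => ⟨x.2, fun h => (hG n).2 h ⟨x.1, rfl⟩⟩⟩, ?_⟩, rfl⟩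
      exact fun h => h ⟨x.1, rfl⟩
    · rintro ⟨⟨y, hy⟩, rfl⟩
      have : y.1 ∈ range e := by
        by_contra hc
        exact hy hc
      obtain ⟨x, hx⟩ := this
      exact ⟨⟨x, by
        have := (mem_iInter.1 y.2 0).1
        rw [← hx] at this; exact this⟩, hx⟩

/-- Embedding everywhere for the given space `X`. -/
theorem embX [Nontrivial T] {k : Cardinal.{u}} (hk : Cardinal.aleph0 ≤ k) {X : Type u}
    [TopologicalSpace X] (e : X → ℕ → T) (he : IsEmbedding e) (hnw : NowhereFsdMinusSLW X k)
    (hG : IsGdeltaSigma (range e))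
    (hsplit : ∀ P : Set (ℕ → T), (∀ U, IsOpen U → (P ∩ U).Nonempty → ¬ Tiny k (P ∩ U)) →
      ∀ U, IsOpen U → (P ∩ U).Nonempty → ∃ v : T → Set (ℕ → T), (∀ t, IsOpen (v t)) ∧
        (∀ t, v t ⊆ U) ∧ (∀ t, (P ∩ v t).Nonempty) ∧ DiscreteFamily v)
    {Z : Type*} [TopologicalSpace Z] (i : Z → ℕ → T) (hi : IsEmbedding i)
    (hZ : IsGdeltaSigma (range i)) : EmbEverywhere Z X := by
  obtain ⟨F0, hF0, hY0⟩ := hG.compl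
  choose C hC hCm hCe using fun n => (hF0 n).mono_form
  set F : ℕ → ℕ → Set (ℕ → T) := fun m j => ⋂ n ∈ Set.Iic m, C n j with hFdef
  have hF : ∀ m j, IsClosed (F m j) := fun m j => isClosed_biInter fun n _ => hC n j
  have hanti : ∀ m j, F (m + 1) j ⊆ F m j := fun m j x hx =>
    mem_iInter₂.2 fun n hn => mem_iInter₂.1 hx n (le_trans hn m.le_succ)
  have hmono : ∀ m, Monotone (F m) := fun m a b hab x hx =>
    mem_iInter₂.2 fun n hn => hCm n hab (mem_iInter₂.1 hx n hn)
  have hY : (range e)ᶜ = ⋂ m, ⋃ j, F m j := by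
    rw [hY0]
    ext x
    simp only [mem_iInter]
    constructor
    · intro h m
      have : ∀ n, ∃ j, x ∈ C n j := fun n => by
        have := h n
        rw [hCe n] at this; exact mem_iUnion.1 this
      choose j hj using this
      refine mem_iUnion.2 ⟨(Finset.range (m + 1)).sup j, mem_iInter₂.2 fun n hn => ?_⟩
      exact hCm n (Finset.le_sup (Finset.mem_range.2 (Nat.lt_succ_of_le hn))) (hj n)
    · intro h m
      obtain ⟨j, hj⟩ := mem_iUnion.1 (h m)
      rw [hCe m]
      exact mem_iUnion.2 ⟨j, mem_iInter₂.1 hj m (Set.mem_Iic.2 le_rfl)⟩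
  have H := schemeX (k := k) hF hanti hmono hY hsplit
  refine embEverywhere_of_scheme H e he ?_ ?_ i hi hZ
  · intro y
    have : y ∈ (range e)ᶜ ↔ ∀ m, ∃ j, y ∈ F m j := by
      rw [hY]; simp only [mem_iInter, mem_iUnion]
    rw [← this, mem_compl_iff, not_not]
  · rintro U hU ⟨y, hyU, hye⟩
    obtain ⟨n, hn⟩ := nhds_seq.1 (hU.mem_nhds hyU)
    have hc := isClopen_cyl n y
    have := not_idI hk e he hnw _ hc.isOpen ⟨y, ag.refl _ _, hye⟩
    obtain ⟨m, P, -, h2, h3⟩ := lemmaA hF hanti hY hc.isClosed this 0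
    exact ⟨m, P, h3, fun x hx => hn x (h2 hx).2⟩

end Start



section Model

variable {T : Type u} [TopologicalSpace T] [DiscreteTopology T]

/-- The closed sets of the model. -/
def mF (t0 : T) (m j : ℕ) : Set (ℕ → T) :=
  {x | ∀ i ≤ m, ∀ l, j ≤ l → x (Nat.pair i l) = t0}

/-- The dense copy of the model. -/
def mA (t0 : T) : Set (ℕ → T) := {x | ∀ m, ∃ j, x ∈ mF t0 m j}

/-- The basic closed sets of the model. -/
def mB (t0 : T) (m n : ℕ) (p : ℕ → T) : Set (ℕ → T) :=
  {x | ag n x p ∧ ∀ i < m, ∀ l, n ≤ Nat.pair i l → x (Nat.pair i l) = t0}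

/-- The family of the model. -/
def mPf (t0 : T) (m : ℕ) (P : Set (ℕ → T)) : Prop := ∃ n p, P = mB t0 m n p

theorem mF_closed (t0 : T) (m j : ℕ) : IsClosed (mF t0 m j) := by
  have : mF t0 m j = ⋂ i, ⋂ (_ : i ≤ m), ⋂ l, ⋂ (_ : j ≤ l), {x | x (Nat.pair i l) = t0} := by
    ext x; simp [mF]
  rw [this]
  refine isClosed_iInter fun i => isClosed_iInter fun _ => isClosed_iInter fun l =>
    isClosed_iInter fun _ => ?_
  exact (isClosed_singleton (x := t0)).preimage (continuous_apply (A := fun _ : ℕ => T) (Nat.pair i l))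

theorem mScheme [Nontrivial T] (t0 : T) : SchemeHyp (mF t0) (mPf t0) where
  closed := mF_closed t0
  mono m a b hab x hx i hi l hl := hx i hi l (hab.trans hl)
  anti m x := by
    rintro ⟨j, hj⟩
    exact ⟨j, fun i hi l hl => hj i (hi.trans m.le_succ) l hl⟩
  next := by
    rintro m _ U ⟨n, p, rfl⟩ hU ⟨y, ⟨hy1, hy2⟩, hyU⟩
    obtain ⟨N0, hN0⟩ := nhds_seq.1 (hU.mem_nhds hyU)
    set N := max n N0 with hN
    have hnN : n ≤ N := le_max_left _ _
    refine ⟨N, m + 1, _, m.lt_succ_self, ⟨N, y, rfl⟩, ?_, ?_, ?_⟩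
    · rintro x ⟨h1, h2⟩
      refine ⟨(h1.mono hnN).trans hy1, fun i hi l hl => ?_⟩
      by_cases h : N ≤ Nat.pair i l
      · exact h2 i (by omega) l h
      · rw [h1 _ (by omega)]
        exact hy2 i hi l hl
    · rintro x ⟨h1, h2⟩
      exact hN0 x (h1.mono (le_max_right _ _))
    · rintro x ⟨h1, h2⟩ i hi l hl
      exact h2 i (by omega) l (hl.trans (Nat.right_le_pair i l))
  nonempty := by
    rintro m _ ⟨n, p, rfl⟩
    refine ⟨fun i => if i < n then p i else t0, fun i hi => by simp [hi], fun i _ l hl => ?_⟩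
    simp [not_lt.2 hl]
  codense := by
    rintro m _ U j ⟨n, p, rfl⟩ hU ⟨y, ⟨hy1, hy2⟩, hyU⟩
    obtain ⟨N0, hN0⟩ := nhds_seq.1 (hU.mem_nhds hyU)
    obtain ⟨t1, ht1⟩ := exists_ne t0
    set l := max j (max n N0) with hl
    have hq : l ≤ Nat.pair m l := Nat.right_le_pair m l
    have hag : ag l (Function.update y (Nat.pair m l) t1) y := fun i hi => by
      rw [Function.update_of_ne (by omega)]
    refine ⟨Function.update y (Nat.pair m l) t1, ⟨(hag.mono (by omega)).trans hy1, ?_⟩,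
      hN0 _ (hag.mono (by omega)), fun h => ?_⟩
    · intro i hi l' hl'
      rw [Function.update_of_ne]
      · exact hy2 i hi l' hl'
      · intro h
        have := (Nat.pair_eq_pair.1 h).1
        omega
    · have := h m le_rfl l (by omega)
      rw [Function.update_self] at this
      exact ht1 this
  split := by
    rintro m _ U ⟨n, p, rfl⟩ hU ⟨y, ⟨hy1, hy2⟩, hyU⟩
    obtain ⟨N0, hN0⟩ := nhds_seq.1 (hU.mem_nhds hyU)
    set l := max n N0 with hl
    set q := Nat.pair m l with hqd
    have hq : l ≤ q := Nat.right_le_pair m l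
    have hag : ∀ t, ag q (Function.update y q t) y := fun t i hi => by
      rw [Function.update_of_ne (by omega)]
    refine ⟨fun t => {x | ag (q + 1) x (Function.update y q t)},
      fun t => (isClopen_cyl _ _).isOpen, ?_, ?_, ?_⟩
    · intro t x hx
      exact hN0 x ((ag.mono hx (by omega)).trans ((hag t).mono (by omega)))
    · intro t
      refine ⟨Function.update y q t, ⟨((hag t).mono (by omega)).trans hy1, ?_⟩, ag.refl _ _⟩
      intro i hi l' hl'
      rw [Function.update_of_ne]
      · exact hy2 i hi l' hl'
      · intro h
        have := (Nat.pair_eq_pair.1 h).1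
        omega
    · refine discrete_cyl (q + 1) (fun t => Function.update y q t) (fun _ => q + 1)
        (fun _ => le_rfl) (fun _ _ _ => rfl) ?_
      intro s t h
      have := h q q.lt_succ_self
      simpa using this

theorem mA_dense (t0 : T) : Dense (mA t0) := by
  intro y
  rw [mem_closure_iff_nhds]
  intro O hO
  obtain ⟨n, hn⟩ := nhds_seq.1 hO
  refine ⟨fun i => if i < n then y i else t0, hn _ fun i hi => by simp [hi], fun m => ⟨n, ?_⟩⟩
  intro i _ l hl
  simp [not_lt.2 (hl.trans (Nat.right_le_pair i l))]

theorem mA_compl_gds (t0 : T) : IsGdeltaSigma (mA t0)ᶜ := by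
  refine ⟨fun m => ⋂ j, (mF t0 m j)ᶜ, fun m => .iInter_of_isOpen fun j =>
    (mF_closed t0 m j).isOpen_compl, ?_⟩
  ext x
  simp [mA]

theorem mEmb [Nontrivial T] (t0 : T) {Z : Type*} [TopologicalSpace Z] (i : Z → ℕ → T)
    (hi : IsEmbedding i) (hZ : IsGdeltaSigma (range i)) :
    EmbEverywhere Z ↥((mA t0)ᶜ) := by
  refine embEverywhere_of_scheme (mScheme t0) Subtype.val IsEmbedding.subtypeVal ?_ ?_ i hi hZ
  · intro y
    rw [Subtype.range_coe]
    rfl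
  · rintro U hU ⟨y, hyU, -⟩
    obtain ⟨n, hn⟩ := nhds_seq.1 (hU.mem_nhds hyU)
    exact ⟨0, _, ⟨n, y, rfl⟩, fun x hx => hn x hx.1⟩

theorem mCompl_nonempty [Nontrivial T] (t0 : T) : ((mA t0)ᶜ).Nonempty := by
  obtain ⟨t1, ht1⟩ := exists_ne t0
  refine ⟨fun _ => t1, fun h => ?_⟩
  obtain ⟨j, hj⟩ := h 0
  exact ht1 (hj 0 le_rfl j le_rfl)

/-- Interleaving two inducing maps. -/
theorem inducing_prod {X Y : Type*} [TopologicalSpace X] [TopologicalSpace Y] {a : X → ℕ → T}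
    {b : Y → ℕ → T} (ha : IsInducing a) (hb : IsInducing b) :
    ∃ c : X × Y → ℕ → T, IsInducing c := by
  have h1 := ha.prodMap hb
  let h := (Homeomorph.sumArrowHomeomorphProdArrow (ι := ℕ) (ι' := ℕ) (X := T)).symm.trans
    (Homeomorph.piCongrLeft (Y := fun _ : ℕ => T) Equiv.natSumNatEquivNat)
  exact ⟨_, h.isInducing.comp h1⟩

theorem rat_inducing [Nontrivial T] : ∃ a : ℚ → ℕ → T, IsInducing a := by
  classical
  obtain ⟨t0, t1, ht⟩ := exists_pair_ne T
  obtain ⟨r, hr⟩ := exists_surjective_nat ℚ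
  let a : ℚ → ℕ → T := fun q n => if (q : ℝ) < r n + √2 then t1 else t0
  have hne : ∀ q r : ℚ, (q : ℝ) ≠ r + √2 := by
    intro q r h
    have : Irrational ((r : ℝ) + √2) := irrational_sqrt_two.ratCast_add r
    exact this ⟨q, h⟩
  have hiff : ∀ (q p : ℚ) n, a q n = a p n ↔ ((q : ℝ) < r n + √2 ↔ (p : ℝ) < r n + √2) := by
    intro q p n
    by_cases h1 : (q : ℝ) < r n + √2 <;> by_cases h2 : (p : ℝ) < r n + √2 <;>
      simp [a, h1, h2, ht, ht.symm]
  have hcont : Continuous a := by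
    refine continuous_pi fun n => ?_
    rw [continuous_iff_continuousAt]
    intro q
    have : ∀ᶠ p in 𝓝 q, a p n = a q n := by
      rcases lt_or_gt_of_ne (hne q (r n)) with h | h
      · have h2 : ∀ᶠ p : ℚ in 𝓝 q, (p : ℝ) < r n + √2 :=
          Rat.continuous_coe_real.continuousAt.eventually_lt_const h
        filter_upwards [h2] with p hp
        rw [hiff]
        simp [hp, h]
      · have h2 : ∀ᶠ p : ℚ in 𝓝 q, r n + √2 < (p : ℝ) :=
          Rat.continuous_coe_real.continuousAt.eventually_const_lt h
        filter_upwards [h2] with p hp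
        rw [hiff]
        simp [not_lt.2 hp.le, not_lt.2 h.le]
    exact tendsto_nhds_of_eventually_eq this
  refine ⟨a, isInducing_iff_nhds.2 fun q => le_antisymm hcont.continuousAt.le_comap ?_⟩
  intro O hO
  have hO' : ∃ ε > 0, ∀ p : ℚ, |(p : ℝ) - q| < ε → p ∈ O := by
    obtain ⟨ε, hε, h⟩ := Metric.mem_nhds_iff.1 hO
    exact ⟨ε, hε, fun p hp => h hp⟩
  obtain ⟨ε, hε, h⟩ := hO'
  obtain ⟨r1, h1, h1'⟩ := exists_rat_btwn (show (q : ℝ) - ε - √2 < q - √2 by linarith)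
  obtain ⟨r2, h2, h2'⟩ := exists_rat_btwn (show (q : ℝ) - √2 < q + ε - √2 by linarith)
  obtain ⟨n1, rfl⟩ := hr r1
  obtain ⟨n2, rfl⟩ := hr r2
  rw [mem_comap]
  refine ⟨{y | ag (max n1 n2 + 1) y (a q)}, (isClopen_cyl _ _).isOpen.mem_nhds (ag.refl _ _), ?_⟩
  intro p hp
  have e1 := (hiff p q n1).1 (hp n1 (by omega))
  have e2 := (hiff p q n2).1 (hp n2 (by omega))
  have g1 : ¬ (p : ℝ) < r n1 + √2 := fun h => by
    have := e1.1 h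
    linarith
  have g2 : (p : ℝ) < r n2 + √2 := e2.2 (by linarith)
  apply h
  rw [abs_lt]
  constructor <;> linarith

theorem emb_rat_prod {Z N : Type*} [TopologicalSpace Z] [TopologicalSpace N]
    (h : EmbEverywhere Z N) : EmbEverywhere Z (ℚ × N) := by
  rintro V hV ⟨⟨q, x⟩, hx⟩
  obtain ⟨f, hf, hr, -⟩ := h ((fun y => (q, y)) ⁻¹' V) (hV.preimage (by fun_prop)) ⟨x, hx⟩
  have hq : IsClosedEmbedding fun y : N => (q, y) := by
    refine ⟨?_, ?_⟩
    · exact isEmbedding_prodMkRight q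
    · have : range (fun y : N => (q, y)) = Prod.fst ⁻¹' {q} := by
        ext ⟨a, b⟩; simp [eq_comm]
      rw [this]
      exact isClosed_singleton.preimage continuous_fst
  refine ⟨_, hq.comp hf, ?_, ?_⟩
  · rintro _ ⟨z, rfl⟩
    exact hr ⟨z, rfl⟩
  · have : range ((fun y : N => (q, y)) ∘ f) ⊆ ({q} : Set ℚ) ×ˢ univ := by
      rintro _ ⟨z, rfl⟩
      simp
    refine subset_empty_iff.1 ((interior_mono this).trans ?_)
    rw [interior_prod_eq, interior_singleton, empty_prod]

/-- The combination of the uniqueness theorem with the model. -/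
theorem homeo_model [Nontrivial T] (t0 : T) {X : Type u} [TopologicalSpace X] [Nonempty X]
    (e : X → ℕ → T) (he : IsEmbedding e) (hG : IsGdeltaSigma (range e))
    (hX : ∀ {Z : Type u} [TopologicalSpace Z] (i : Z → ℕ → T), IsEmbedding i →
      IsGdeltaSigma (range i) → EmbEverywhere Z X)
    (hcat : FirstCategory X) : Nonempty (X ≃ₜ (ℚ × ↥((mA t0)ᶜ))) := by
  obtain ⟨a, ha⟩ := rat_inducing (T := T)
  obtain ⟨e', he'⟩ := inducing_prod ha (IsInducing.subtypeVal (t := (mA t0)ᶜ))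
  haveI : Nonempty ↥((mA t0)ᶜ) := (mCompl_nonempty t0).to_subtype
  have hcov : ∃ C : ℕ → Set X, (∀ n, IsClosed (C n)) ∧ (∀ n, interior (C n) = ∅) ∧
      ⋃ n, C n = univ := by
    obtain ⟨S, hS, hSc, hSu⟩ := isMeagre_iff_countable_union_isNowhereDense.1 hcat
    have hne : S.Nonempty := by
      by_contra h
      rw [not_nonempty_iff_eq_empty] at h
      subst h
      obtain ⟨x⟩ := ‹Nonempty X›
      have := hSu (mem_univ x)
      simp at this
    obtain ⟨f, hf⟩ := hSc.exists_eq_range hne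
    refine ⟨fun n => closure (f n), fun n => isClosed_closure, fun n => ?_, ?_⟩
    · exact hS _ (hf ▸ mem_range_self n)
    · refine eq_univ_of_forall fun x => ?_
      obtain ⟨s, hs, hx⟩ := hSu (mem_univ x)
      rw [hf] at hs
      obtain ⟨n, rfl⟩ := hs
      exact mem_iUnion.2 ⟨n, subset_closure hx⟩
  obtain ⟨C, hC, hCi, hCu⟩ := hcov
  obtain ⟨r, hr⟩ := exists_surjective_nat ℚ
  refine BF e he.isInducing e' he' C hC hCi hCu ?_ (fun n => Prod.fst ⁻¹' {r n})
    (fun n => isClosed_singleton.preimage continuous_fst) ?_ ?_ ?_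
  · intro n
    refine emb_rat_prod (mEmb t0 (fun z : C n => e z.1) (he.comp IsEmbedding.subtypeVal) ?_)
    obtain ⟨W, hW, hWe⟩ := he.isInducing.isClosed_iff.1 (hC n)
    obtain ⟨G, hGd, hGe⟩ := hG
    refine ⟨fun j => W ∩ G j, fun j => hW.isGδ.inter (hGd j), ?_⟩
    rw [← inter_iUnion, ← hGe]
    ext y
    constructor
    · rintro ⟨⟨z, hz⟩, rfl⟩
      refine ⟨?_, z, rfl⟩
      rw [← hWe] at hz
      exact hz
    · rintro ⟨h1, x, rfl⟩
      exact ⟨⟨x, by rw [← hWe]; exact h1⟩, rfl⟩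
  · intro n
    have : (Prod.fst ⁻¹' {r n} : Set (ℚ × ↥((mA t0)ᶜ))) = {r n} ×ˢ univ := by
      ext; simp
    rw [this, interior_prod_eq, interior_singleton, empty_prod]
  · exact eq_univ_of_forall fun z => mem_iUnion.2 ((hr z.1).imp fun n hn => hn.symm)
  · intro n
    have hi : IsEmbedding fun z : ↥(Prod.fst ⁻¹' {r n} : Set (ℚ × ↥((mA t0)ᶜ))) => z.1.2 := by
      let g : ↥((mA t0)ᶜ) → ↥(Prod.fst ⁻¹' {r n} : Set (ℚ × ↥((mA t0)ᶜ))) :=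
        fun y => ⟨(r n, y), rfl⟩
      let H : ↥(Prod.fst ⁻¹' {r n} : Set (ℚ × ↥((mA t0)ᶜ))) ≃ₜ ↥((mA t0)ᶜ) :=
        { toFun := fun z => z.1.2
          invFun := g
          left_inv := by
            rintro ⟨⟨q, y⟩, hq⟩
            have : q = r n := hq
            subst this
            rfl
          right_inv := fun y => rfl
          continuous_toFun := by fun_prop
          continuous_invFun := by fun_prop }
      exact H.isEmbedding
    refine hX _ (IsEmbedding.subtypeVal.comp hi) ?_
    convert mA_compl_gds t0 using 1
    ext y
    constructor
    · rintro ⟨z, rfl⟩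
      exact z.1.2.2
    · intro hy
      exact ⟨⟨(r n, ⟨y, hy⟩), rfl⟩, rfl⟩

end Model



section Sigma

/-- Eventually constant sequences. -/
def SigT (T : Type u) (t0 : T) : Type u := {x : ℕ → T // ∀ᶠ n in Filter.atTop, x n = t0}

instance (T : Type u) [TopologicalSpace T] (t0 : T) : TopologicalSpace (SigT T t0) :=
  inferInstanceAs (TopologicalSpace {x : ℕ → T // ∀ᶠ n in Filter.atTop, x n = t0})

theorem SigT.val_emb (T : Type u) [TopologicalSpace T] (t0 : T) :
    IsEmbedding (fun x : SigT T t0 => x.1) := IsEmbedding.subtypeVal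

instance (T : Type u) [Countable T] (t0 : T) : Countable (SigT T t0) := by
  let f : List T → SigT T t0 := fun l => ⟨fun n => l.getD n t0, by
    filter_upwards [eventually_ge_atTop l.length] with n hn
    exact List.getD_eq_default _ _ hn⟩
  refine Function.Surjective.countable (f := f) ?_
  rintro ⟨x, hx⟩
  obtain ⟨N, hN⟩ := eventually_atTop.1 hx
  refine ⟨(List.range N).map x, Subtype.ext (funext fun n => ?_)⟩
  by_cases h : n < N
  · simp [f, List.getD, h]
  · have : ((List.range N).map x).getD n t0 = t0 := List.getD_eq_default _ _ (by simpa using h)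
    exact this.trans (hN n (by omega)).symm

theorem SigT.no_isol (T : Type u) [TopologicalSpace T] [DiscreteTopology T] [Nontrivial T] (t0 : T)
    (x : SigT T t0) : interior ({x} : Set (SigT T t0)) = ∅ := by
  rw [← not_nonempty_iff_eq_empty]
  rintro ⟨y, hy⟩
  have hyx : y = x := mem_singleton_iff.1 (interior_subset hy)
  subst hyx
  have h : ({y} : Set (SigT T t0)) ∈ 𝓝 y := mem_interior_iff_mem_nhds.1 hy
  obtain ⟨n, hn⟩ := (nhds_ind (SigT.val_emb T t0).isInducing).1 h
  obtain ⟨N, hN⟩ := eventually_atTop.1 y.2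
  obtain ⟨t1, ht1⟩ := exists_ne t0
  let z : SigT T t0 := ⟨Function.update y.1 (max n N) t1, by
    filter_upwards [eventually_gt_atTop (max n N)] with m hm
    rw [Function.update_of_ne hm.ne']
    exact hN m (by omega)⟩
  have hz : z = y := hn z fun i hi => by
    have : i ≠ max n N := by omega
    exact Function.update_of_ne this _ _
  have h1 : z.1 (max n N) = t1 := Function.update_self _ _ _
  rw [hz, hN _ (le_max_right _ _)] at h1
  exact ht1 h1.symm

theorem homeo_countable {T : Type*} [TopologicalSpace T] [DiscreteTopology T] {X M : Type*}
    [TopologicalSpace X] [TopologicalSpace M] [T1Space X] [T1Space M]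
    [Nonempty X] [Nonempty M] [Countable X] [Countable M]
    (e : X → ℕ → T) (he : IsInducing e) (e' : M → ℕ → T) (he' : IsInducing e')
    (hX : ∀ x : X, interior ({x} : Set X) = ∅) (hM : ∀ x : M, interior ({x} : Set M) = ∅) :
    Nonempty (X ≃ₜ M) := by
  obtain ⟨r, hr⟩ := exists_surjective_nat X
  obtain ⟨s, hs⟩ := exists_surjective_nat M
  have key : ∀ {A B : Type _} [TopologicalSpace A] [TopologicalSpace B] [T1Space A] [T1Space B]
      (_ : ∀ x : B, interior ({x} : Set B) = ∅) (a : A), EmbEverywhere ({a} : Set A) B := by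
    rintro A B _ _ _ _ hB a V hV ⟨b, hb⟩
    have hsr : range (fun _ : ({a} : Set A) => b) = {b} := by
      ext y; simp [eq_comm]
    refine ⟨fun _ => b, ⟨⟨⟨?_⟩, fun _ _ _ => Subsingleton.elim _ _⟩, ?_⟩, ?_, ?_⟩
    · exact Subsingleton.elim _ _
    · rw [hsr]; exact isClosed_singleton
    · rw [hsr]; simpa using hb
    · rw [hsr]; exact hB b
  have key' : ∀ {A B : Type _} [TopologicalSpace A] [TopologicalSpace B] [T1Space A] [T1Space B]
      (_ : ∀ x : B, interior ({x} : Set B) = ∅) (a : A), EmbEverywhere ({a} : Set A) B := by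
    rintro A B _ _ _ _ hB a V hV ⟨b, hb⟩
    have hsr : range (fun _ : ({a} : Set A) => b) = {b} := by
      ext y; simp [eq_comm]
    refine ⟨fun _ => b, ⟨⟨⟨?_⟩, fun _ _ _ => Subsingleton.elim _ _⟩, ?_⟩, ?_, ?_⟩
    · exact Subsingleton.elim _ _
    · rw [hsr]; exact isClosed_singleton
    · rw [hsr]; simpa using hb
    · rw [hsr]; exact hB b
  refine BF e he e' he' (fun n => {r n}) (fun _ => isClosed_singleton) (fun _ => hX _) ?_
    (fun n => key hM _) (fun n => {s n}) (fun _ => isClosed_singleton) (fun _ => hM _) ?_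
    (fun n => key' hX _)
  · exact eq_univ_of_forall fun z => mem_iUnion.2 ((hr z).imp fun n hn => hn.symm)
  · exact eq_univ_of_forall fun z => mem_iUnion.2 ((hs z).imp fun n hn => hn.symm)

theorem inducing_post {S T : Type*} [TopologicalSpace S] [DiscreteTopology S] [TopologicalSpace T]
    [DiscreteTopology T] {f : S → T} (hf : Function.Injective f) :
    IsInducing (fun (x : ℕ → S) n => f (x n)) := by
  have hf' : IsInducing f := by
    refine isInducing_iff_nhds.2 fun x => ?_
    rw [nhds_discrete, nhds_discrete, Filter.comap_pure]
    have : f ⁻¹' {f x} = {x} := by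
      ext y; simp [hf.eq_iff]
    rw [this, principal_singleton]
  exact IsInducing.piMap fun _ => hf'

theorem mA_homeo {T : Type u} [TopologicalSpace T] [DiscreteTopology T] (t0 : T) :
    Nonempty (↥(mA t0) ≃ₜ (ℕ → SigT T t0)) := by
  have h1 : ∀ x, x ∈ mA t0 ↔ ∀ i, ∀ᶠ l in atTop, x (Nat.pair i l) = t0 := by
    intro x
    constructor
    · intro h i
      obtain ⟨j, hj⟩ := h i
      exact eventually_atTop.2 ⟨j, fun l hl => hj i le_rfl l hl⟩
    · intro h m
      choose j hj using fun i => eventually_atTop.1 (h i)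
      refine ⟨(Finset.range (m + 1)).sup j, fun i hi l hl => hj i l ?_⟩
      exact (Finset.le_sup (Finset.mem_range.2 (Nat.lt_succ_of_le hi))).trans hl
  exact ⟨{
    toFun := fun x i => ⟨fun l => x.1 (Nat.pair i l), (h1 x.1).1 x.2 i⟩
    invFun := fun y => ⟨fun n => (y n.unpair.1).1 n.unpair.2, (h1 _).2 fun i => by
      simpa using (y i).2⟩
    left_inv := fun x => by
      apply Subtype.ext
      funext n
      simp
    right_inv := fun y => by
      funext i
      apply Subtype.ext
      funext l
      simp
    continuous_toFun := by
      refine continuous_pi fun i => ?_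
      refine (SigT.val_emb T t0).continuous_iff.2 ?_
      refine continuous_pi fun l => ?_
      exact (continuous_apply (A := fun _ : ℕ => T) (Nat.pair i l)).comp continuous_subtype_val
    continuous_invFun := by
      refine Continuous.subtype_mk (continuous_pi fun n => ?_) _
      exact (continuous_apply (A := fun _ : ℕ => T) n.unpair.2).comp
        ((SigT.val_emb T t0).continuous.comp (continuous_apply n.unpair.1)) }⟩

theorem SigT.congr {S T : Type u} [TopologicalSpace S] [DiscreteTopology S] [TopologicalSpace T]
    [DiscreteTopology T] (b : S ≃ T) (s0 : S) (t0 : T) (h : b s0 = t0) :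
    Nonempty (SigT S s0 ≃ₜ SigT T t0) := by
  subst h
  exact ⟨{
    toFun := fun x => ⟨fun n => b (x.1 n), x.2.mono fun n hn => by dsimp only; rw [hn]⟩
    invFun := fun x => ⟨fun n => b.symm (x.1 n), x.2.mono fun n hn => by
      dsimp only; rw [hn, b.symm_apply_apply]⟩
    left_inv := fun x => by apply Subtype.ext; funext n; simp
    right_inv := fun x => by apply Subtype.ext; funext n; simp
    continuous_toFun := by
      refine (SigT.val_emb T _).continuous_iff.2 ?_
      exact (inducing_post b.injective).continuous.comp (SigT.val_emb S s0).continuous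
    continuous_invFun := by
      refine (SigT.val_emb S _).continuous_iff.2 ?_
      exact (inducing_post b.symm.injective).continuous.comp (SigT.val_emb T _).continuous }⟩

/-- The base point. -/
def qb (k : Cardinal.{u}) : QBase k := Sum.inr PUnit.unit

theorem Qk_eq (k : Cardinal.{u}) : Nonempty (SigT (QBase k) (qb k) ≃ₜ Qk k) :=
  ⟨Homeomorph.refl _⟩

theorem mk_QBase {k : Cardinal.{u}} (hk : Cardinal.aleph0 ≤ k) : Cardinal.mk (QBase k) = k := by
  have : Cardinal.mk (QBase k) = k + 1 := by
    unfold QBase DiscT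
    simp
  rw [this, Cardinal.add_one_eq hk]

theorem mk_StarT {k : Cardinal.{u}} (hk : Cardinal.aleph0 < k) : Cardinal.mk (StarT k) = k := by
  unfold StarT
  rw [if_neg hk.ne']
  unfold DiscT
  simp

theorem starT_bool : Nonempty (StarT Cardinal.aleph0.{u} ≃ Bool) := by
  unfold StarT
  rw [if_pos rfl]
  exact ⟨Equiv.ulift⟩

theorem model_exists {k : Cardinal.{u}} (hk : Cardinal.aleph0 ≤ k) :
    ∃ t0 : StarT k, Nonempty (SigT (StarT k) t0 ≃ₜ Qk k) := by
  obtain ⟨q⟩ := Qk_eq k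
  rcases hk.eq_or_lt with rfl | hk'
  · obtain ⟨b⟩ := starT_bool.{u}
    have hcQ : Countable (QBase Cardinal.aleph0.{u}) :=
      Cardinal.mk_le_aleph0_iff.1 (mk_QBase hk).le
    have hnQ : Nontrivial (QBase Cardinal.aleph0.{u}) := by
      rw [← Cardinal.one_lt_iff_nontrivial, mk_QBase hk]
      exact Cardinal.one_lt_aleph0
    have hcS : Countable (StarT Cardinal.aleph0.{u}) := b.injective.countable
    have hnS : Nontrivial (StarT Cardinal.aleph0.{u}) := b.nontrivial
    obtain ⟨t0, t1, h01⟩ := exists_pair_ne (StarT Cardinal.aleph0.{u})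
    obtain ⟨q0, q1, hq⟩ := exists_pair_ne (QBase Cardinal.aleph0.{u})
    have hT1 : T1Space (SigT (StarT Cardinal.aleph0.{u}) t0) := (SigT.val_emb _ t0).t1Space
    have hT2 : T1Space (SigT (QBase Cardinal.aleph0.{u}) (qb Cardinal.aleph0.{u})) :=
      (SigT.val_emb _ _).t1Space
    have : Nonempty (SigT (StarT Cardinal.aleph0.{u}) t0) :=
      ⟨⟨fun _ => t0, Eventually.of_forall fun _ => rfl⟩⟩
    have : Nonempty (SigT (QBase Cardinal.aleph0.{u}) (qb Cardinal.aleph0.{u})) :=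
      ⟨⟨fun _ => _, Eventually.of_forall fun _ => rfl⟩⟩
    have hinj : Function.Injective fun t => if b t then q0 else q1 := by
      intro s t h
      apply b.injective
      by_cases h1 : b s = true <;> by_cases h2 : b t = true <;> simp_all [hq.symm]
    obtain ⟨h⟩ := homeo_countable (X := SigT (StarT Cardinal.aleph0.{u}) t0)
      (M := SigT (QBase Cardinal.aleph0.{u}) (qb Cardinal.aleph0.{u}))
      _ ((inducing_post hinj).comp (SigT.val_emb _ _).isInducing) _ (SigT.val_emb _ _).isInducing
      (SigT.no_isol _ _) (SigT.no_isol _ _)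
    exact ⟨t0, ⟨h.trans q⟩⟩
  · have : Cardinal.mk (QBase k) = Cardinal.mk (StarT k) := by rw [mk_QBase hk, mk_StarT hk']
    obtain ⟨b⟩ := Cardinal.eq.1 this
    obtain ⟨h⟩ := SigT.congr b (qb k) _ rfl
    exact ⟨_, ⟨h.symm.trans q⟩⟩

theorem mA_QkOmega {k : Cardinal.{u}} (t0 : StarT k) (h : Nonempty (SigT (StarT k) t0 ≃ₜ Qk k)) :
    Nonempty (↥(mA t0) ≃ₜ QkOmega k) := by
  obtain ⟨a⟩ := mA_homeo t0
  obtain ⟨h⟩ := h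
  exact ⟨a.trans (Homeomorph.piCongrRight fun _ => h)⟩

end Sigma



section EmbedX

theorem exists_locConst {X : Type u} [MetricSpace X] [Nonempty X] (hz : StronglyZeroDim X) {ε : ℝ}
    (hε : 0 < ε) : ∃ q : X → X, (∀ x, ∀ᶠ y in 𝓝 x, q y = q x) ∧ ∀ x, dist x (q x) < ε := by
  obtain ⟨v, hvo, hvc, hvf, hvu⟩ := precise_refinement (fun a : X => Metric.ball a ε)
    (fun _ => Metric.isOpen_ball)
    (eq_univ_of_forall fun x => mem_iUnion.2 ⟨x, Metric.mem_ball_self hε⟩)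
  obtain ⟨w, hwc, hwcl, hwv⟩ := exists_iUnion_eq_closed_subset hvo (fun x => hvf.point_finite x) hvc
  choose O hO hwO hOv using fun a => hz (w a) (v a)ᶜ (hwcl a) (hvo a).isClosed_compl
    (disjoint_compl_right_iff_subset.2 (hwv a))
  have hOv' : ∀ a, O a ⊆ v a := fun a => by
    have := (hOv a).symm
    rwa [disjoint_compl_right_iff_subset] at this
  refine ⟨fun x => selIn {a | x ∈ O a}, fun x => ?_, fun x => ?_⟩
  · obtain ⟨N, hN, hfin⟩ := hvf x
    have h1 : ∀ᶠ y in 𝓝 x, ∀ a ∈ {i | (v i ∩ N).Nonempty}, (y ∈ O a ↔ x ∈ O a) :=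
      (hfin.eventually_all).2 fun a _ => loc_of_isClopen (hO a) x
    filter_upwards [h1, hN] with y hy hyN
    have hxN : x ∈ N := mem_of_mem_nhds hN
    have : {a | y ∈ O a} = {a | x ∈ O a} := by
      ext a
      by_cases ha : (v a ∩ N).Nonempty
      · exact hy a ha
      · constructor
        · intro h
          exact absurd ⟨y, hOv' a h, hyN⟩ ha
        · intro h
          exact absurd ⟨x, hOv' a h, hxN⟩ ha
    rw [this]
  · have hne : {a | x ∈ O a}.Nonempty := by
      have : x ∈ ⋃ a, w a := by rw [hwc]; trivial
      obtain ⟨a, ha⟩ := mem_iUnion.1 this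
      exact ⟨a, hwO a ha⟩
    have : x ∈ O (selIn {a | x ∈ O a}) := selIn_mem hne
    exact hvu _ (hOv' _ this)

theorem exists_base (X : Type u) [TopologicalSpace X] :
    ∃ B : Set (Set X), TopologicalSpace.IsTopologicalBasis B ∧ Cardinal.mk B = topWeight X := by
  have : Nonempty {B : Set (Set X) // TopologicalSpace.IsTopologicalBasis B} :=
    ⟨⟨_, TopologicalSpace.isTopologicalBasis_opens⟩⟩
  obtain ⟨B, hB⟩ := ciInf_mem
    fun B : {B : Set (Set X) // TopologicalSpace.IsTopologicalBasis B} => Cardinal.mk B.1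
  exact ⟨B.1, B.2, hB⟩

theorem emb_disc {k : Cardinal.{u}} {X : Type u} [TopologicalSpace X]
    [TopologicalSpace.MetrizableSpace X] [Nonempty X] (hz : StronglyZeroDim X)
    (hw : topWeight X = k) : ∃ e : X → ℕ → DiscT k, IsInducing e := by
  letI := TopologicalSpace.metrizableSpaceMetric X
  choose q hq hqd using fun n : ℕ => exists_locConst hz (ε := 1 / ((n : ℝ) + 1)) (by positivity)
  obtain ⟨B, hB, hBk⟩ := exists_base X
  have hinj : ∀ n, ∃ g : range (q n) → DiscT k, Function.Injective g := by
    intro n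
    have h1 : ∀ c : range (q n), ∃ b ∈ B, b.Nonempty ∧ ∀ y ∈ b, q n y = c.1 := by
      rintro ⟨_, x, rfl⟩
      obtain ⟨b, hb, hxb, hs⟩ := hB.mem_nhds_iff.1 (hq n x)
      exact ⟨b, hb, ⟨x, hxb⟩, fun y hy => hs hy⟩
    choose b hbB hbn hbq using h1
    have h2 : Function.Injective fun c => (⟨b c, hbB c⟩ : B) := by
      intro c d h
      have h' : b c = b d := Subtype.ext_iff.1 h
      obtain ⟨y, hy⟩ := hbn c
      apply Subtype.ext
      rw [← hbq c y hy, ← hbq d y (h' ▸ hy)]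
    have h3 : Cardinal.mk B = Cardinal.mk (DiscT k) := by
      rw [hBk, hw]
      unfold DiscT
      simp
    obtain ⟨φ⟩ := Cardinal.eq.1 h3
    exact ⟨_, φ.injective.comp h2⟩
  choose g hg using hinj
  refine ⟨fun x n => g n ⟨q n x, x, rfl⟩, isInducing_iff_nhds.2 fun x => le_antisymm ?_ ?_⟩
  · refine Filter.map_le_iff_le_comap.1 ?_
    refine tendsto_pi_nhds.2 fun n => ?_
    refine tendsto_nhds_of_eventually_eq ?_
    filter_upwards [hq n x] with y hy
    congr 1
    exact Subtype.ext hy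
  · intro O hO
    obtain ⟨ε, hε, h⟩ := Metric.mem_nhds_iff.1 hO
    obtain ⟨n, hn⟩ := exists_nat_one_div_lt (show 0 < ε / 2 by linarith)
    rw [mem_comap]
    refine ⟨_, (isClopen_cyl (n + 1) _).isOpen.mem_nhds (ag.refl _ _), ?_⟩
    intro y hy
    have h1 := hg n (hy n n.lt_succ_self)
    have h2 : q n y = q n x := Subtype.ext_iff.1 h1
    apply h
    have h3 := hqd n y
    have h4 := hqd n x
    rw [h2] at h3
    have h5 := dist_triangle_right y x (q n x)
    rw [Metric.mem_ball]
    linarith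

theorem nat_inducing {T : Type*} [TopologicalSpace T] [DiscreteTopology T] [Nontrivial T] :
    ∃ c : (ℕ → ℕ) → ℕ → T, IsInducing c := by
  classical
  obtain ⟨t0, t1, ht⟩ := exists_pair_ne T
  let c : (ℕ → ℕ) → ℕ → T := fun x n => if x n.unpair.1 = n.unpair.2 then t1 else t0
  refine ⟨c, isInducing_iff_nhds.2 fun x => le_antisymm ?_ ?_⟩
  · refine Filter.map_le_iff_le_comap.1 ?_
    refine tendsto_pi_nhds.2 fun n => ?_
    refine tendsto_nhds_of_eventually_eq ?_
    refine nhds_seq.2 ⟨n.unpair.1 + 1, fun y hy => ?_⟩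
    have := hy n.unpair.1 (Nat.lt_succ_self _)
    show c y n = c x n
    simp only [c, this]
  · intro O hO
    obtain ⟨n, hn⟩ := nhds_seq.1 hO
    rw [mem_comap]
    refine ⟨_, (isClopen_cyl ((Finset.range n).sup (fun i => Nat.pair i (x i)) + 1) _).isOpen.mem_nhds
      (ag.refl _ _), ?_⟩
    intro y hy
    refine hn y fun i hi => ?_
    have h1 : Nat.pair i (x i) ≤ (Finset.range n).sup (fun i => Nat.pair i (x i)) :=
      Finset.le_sup (f := fun i => Nat.pair i (x i)) (Finset.mem_range.2 hi)
    have h2 : c y (Nat.pair i (x i)) = c x (Nat.pair i (x i)) := hy _ (Nat.lt_succ_of_le h1)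
    simp only [c, Nat.unpair_pair, if_true] at h2
    by_contra h3
    rw [if_neg h3] at h2
    exact ht h2

theorem starT_nontrivial {k : Cardinal.{u}} (hk : Cardinal.aleph0 ≤ k) : Nontrivial (StarT k) := by
  rcases hk.eq_or_lt with rfl | hk'
  · obtain ⟨b⟩ := starT_bool.{u}
    exact b.nontrivial
  · rw [← Cardinal.one_lt_iff_nontrivial, mk_StarT hk']
    exact Cardinal.one_lt_aleph0.trans hk'

theorem disc_star {k : Cardinal.{u}} (hk : Cardinal.aleph0 ≤ k) :
    ∃ c : (ℕ → DiscT k) → ℕ → StarT k, IsInducing c := by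
  have hnt := starT_nontrivial hk
  have hD : Cardinal.mk (DiscT k) = k := by
    unfold DiscT
    simp
  rcases hk.eq_or_lt with h | hk'
  · have : Countable (DiscT k) := Cardinal.mk_le_aleph0_iff.1 (hD.trans h.symm).le
    obtain ⟨f, hf⟩ := Countable.exists_injective_nat (DiscT k)
    obtain ⟨c, hc⟩ := nat_inducing (T := StarT k)
    exact ⟨_, hc.comp (inducing_post hf)⟩
  · obtain ⟨b⟩ := Cardinal.eq.1 (hD.trans (mk_StarT hk').symm)
    exact ⟨_, inducing_post b.injective⟩

end EmbedX

/-- Theorem `t-ak1`: a topological characterization of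
`A^I_k = Q × A^{II}_k`. -/
theorem stmt_17 (k : Cardinal.{u}) (hk : Cardinal.aleph0 ≤ k)
    (X : Type u) [TopologicalSpace X]
    (habs : AbsGdeltaSigma X) (hcat : FirstCategory X)
    (hind : StronglyZeroDim X) (hnw : NowhereFsdMinusSLW X k)
    (hw : topWeight X = k) :
    IsAI k X := by
  have hm := habs.1
  have hne : Nonempty X := by
    by_contra h
    rw [not_nonempty_iff] at h
    have hb : TopologicalSpace.IsTopologicalBasis (∅ : Set (Set X)) :=
      TopologicalSpace.isTopologicalBasis_of_isOpen_of_nhds (fun _ h => h.elim)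
        (fun a => isEmptyElim a)
    have h1 : topWeight X ≤ Cardinal.mk (∅ : Set (Set X)) :=
      ciInf_le' (fun B : {B : Set (Set X) // TopologicalSpace.IsTopologicalBasis B} =>
        Cardinal.mk B.1) ⟨∅, hb⟩
    rw [hw, Cardinal.mk_eq_zero] at h1
    exact absurd (hk.trans h1) (not_le.2 Cardinal.aleph0_pos)
  have hnt := starT_nontrivial hk
  obtain ⟨e1, he1⟩ := emb_disc hind hw
  obtain ⟨c, hc⟩ := disc_star hk
  have he : IsEmbedding (c ∘ e1) := (hc.comp he1).isEmbedding
  have hG : IsGdeltaSigma (range (c ∘ e1)) := habs.2 (ℕ → StarT k) (c ∘ e1) he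
  obtain ⟨t0, ht0⟩ := model_exists hk
  have hsplit : ∀ P : Set (ℕ → StarT k),
      (∀ U, IsOpen U → (P ∩ U).Nonempty → ¬ Tiny k (P ∩ U)) →
      ∀ U, IsOpen U → (P ∩ U).Nonempty → ∃ v : StarT k → Set (ℕ → StarT k), (∀ t, IsOpen (v t)) ∧
        (∀ t, v t ⊆ U) ∧ (∀ t, (P ∩ v t).Nonempty) ∧ DiscreteFamily v := by
    intro P hP U hU hne
    rcases hk.eq_or_lt with h | hk'
    · subst h
      obtain ⟨b⟩ := starT_bool.{u}
      exact split_two hk b hP U hU hne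
    · exact split_big hk' (mk_StarT hk') hP U hU hne
  refine ⟨mA t0, mA_dense t0, mA_QkOmega t0 ht0, ?_⟩
  exact homeo_model t0 (c ∘ e1) he hG
    (fun i hi hZ => embX hk (c ∘ e1) he hnw hG hsplit i hi hZ) hcat
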